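/- arXiv:2302.05273 — 2 statements merged into one kernel-verified Lean document; each statement's English description precedes it below -/
import Mathlib

section
/- Let T > 0 and let A : [0,T] → [0,∞) be monotone increasing. Let N : [0,T] × ℝ → ℂ be continuous, such that N(s,·) is a Schwartz function for each s ∈ [0,T], every Schwartz seminorm of N(s,·) is bounded uniformly in s ∈ [0,T], and ‖⟨x⟩² ⟨D⟩N(s)‖_{L²(ℝ)} ≤ A(s) ⟨s⟩^{-3/2} for all s ∈ [0,T], where ⟨D⟩N(s) has Fourier transform ⟨ξ⟩ N̂(s,ξ). Then there exists an absolute constant C ≥ 1 such that for all t ∈ [0,T], ‖⟨ξ⟩² ∂_ξ ∫₀ᵗ (2i⟨ξ⟩)⁻¹ e^{-is⟨ξ⟩} N̂(s,ξ) ds‖_{L²_ξ(ℝ)} ≤ C A(t) (log(2+t))^{1/2}. -/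
open MeasureTheory

noncomputable section

/-- The Fourier transform `f̂(ξ) = (2π)^{-1/2} ∫ e^{-ixξ} f(x) dx`. -/
def FT (f : ℝ → ℂ) (ξ : ℝ) : ℂ :=
  (Real.sqrt (2 * Real.pi) : ℂ)⁻¹ * ∫ x : ℝ, Complex.exp (-(Complex.I * (x : ℂ) * (ξ : ℂ))) * f x

/-- The Fourier multiplier `⟨D⟩` with symbol `⟨ξ⟩ = (1+ξ²)^{1/2}`:
`(⟨D⟩g)(x) = (2π)^{-1/2} ∫ e^{ixξ} ⟨ξ⟩ ĝ(ξ) dξ`. -/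
def jbD (g : ℝ → ℂ) (x : ℝ) : ℂ :=
  (Real.sqrt (2 * Real.pi) : ℂ)⁻¹ *
    ∫ ξ : ℝ, Complex.exp (Complex.I * (x : ℂ) * (ξ : ℂ)) *
      ((Real.sqrt (1 + ξ ^ 2) : ℝ) : ℂ) * FT g ξ

open FourierTransform SchwartzMap in
lemma FT_eq_fourier (f : ℝ → ℂ) (ξ : ℝ) :
    FT f ξ = (Real.sqrt (2 * Real.pi) : ℂ)⁻¹ * 𝓕 f (ξ / (2 * Real.pi)) := by
  rw [FT, Real.fourier_real_eq_integral_exp_smul]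
  congr 2
  ext x
  rw [smul_eq_mul]
  congr 2
  have : (Real.pi : ℂ) ≠ 0 := by exact_mod_cast Real.pi_ne_zero
  push_cast
  field_simp

open FourierTransform SchwartzMap in
lemma fourier_Lp_ae (f : ℝ → ℂ) (h1 : Integrable f) (h2 : MemLp f 2) :
    (𝓕 (h2.toLp f) : Lp (α := ℝ) ℂ 2) =ᵐ[volume] 𝓕 f := by
  have hcont : Continuous (𝓕 f : ℝ → ℂ) :=
    VectorFourier.fourierIntegral_continuous Real.continuous_fourierChar
      (by exact continuous_inner) h1
  have hloc : LocallyIntegrable ((𝓕 (h2.toLp f) : Lp (α := ℝ) ℂ 2 volume) : ℝ → ℂ) volume :=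
    (Lp.memLp _).locallyIntegrable (by norm_num)
  refine ae_eq_of_integral_contDiff_smul_eq hloc hcont.locallyIntegrable ?_
  intro g hg hgc
  have hgc' : HasCompactSupport (fun x => (g x : ℂ)) := hgc.comp_left (g := Complex.ofReal) rfl
  have hg' : ContDiff ℝ (⊤ : ℕ∞) (fun x => (g x : ℂ)) := Complex.ofRealCLM.contDiff.comp hg
  set φ : 𝓢(ℝ, ℂ) := hgc'.toSchwartzMap hg' with hφ
  have hφx : ∀ x, φ x = (g x : ℂ) := fun x => rfl
  have e1 := congrArg (fun T => T φ) (Lp.fourier_toTemperedDistribution_eq (h2.toLp f))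
  simp only [TemperedDistribution.fourier_apply, Lp.toTemperedDistribution_apply] at e1
  have e2 : ∫ x, 𝓕 φ x • (h2.toLp f : ℝ → ℂ) x = ∫ x, 𝓕 φ x • f x := by
    apply integral_congr_ae
    filter_upwards [h2.coeFn_toLp] with x hx
    rw [hx]
  have e3 : ∫ x, (𝓕 (φ : ℝ → ℂ)) x • f x = ∫ x, φ x • (𝓕 f) x := by
    have := VectorFourier.integral_fourierIntegral_smul_eq_flip (L := innerₗ ℝ) (μ := volume)
      (ν := volume) Real.continuous_fourierChar (by exact continuous_inner) φ.integrable h1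
    rw [flip_innerₗ] at this
    exact this
  calc _ = ∫ x, φ x • ((𝓕 (h2.toLp f) : Lp (α := ℝ) ℂ 2 volume) : ℝ → ℂ) x := by
        simp [hφx]
    _ = ∫ x, φ x • (𝓕 f) x := by rw [← e1, e2, ← e3]; rfl
    _ = _ := by simp [hφx]

open FourierTransform in
lemma plancherel_le (f : ℝ → ℂ) (hf : AEStronglyMeasurable f) :
    ∫⁻ ξ, ‖𝓕 f ξ‖ₑ ^ 2 ≤ ∫⁻ x, ‖f x‖ₑ ^ 2 := by
  by_cases h1 : Integrable f
  swap
  · have : ∀ ξ, (𝓕 f : ℝ → ℂ) ξ = 0 := by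
      intro ξ
      rw [Real.fourier_real_eq]
      apply integral_undef
      intro h
      apply h1
      have := (Real.fourierIntegral_convergent_iff (f := f) (μ := volume) ξ).1
      refine this ?_
      convert h using 4
      simp [mul_comm]
    simp [this]
  by_cases h2 : ∫⁻ x, ‖f x‖ₑ ^ 2 = ⊤
  · rw [h2]; exact le_top
  have hm : ∀ g : ℝ → ℂ, eLpNorm g 2 volume = (∫⁻ x, ‖g x‖ₑ ^ 2) ^ (1/2 : ℝ) := by
    intro g
    rw [eLpNorm_eq_lintegral_rpow_enorm_toReal (by norm_num) (by norm_num)]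
    norm_num
  have h2' : MemLp f 2 := by
    refine ⟨hf, ?_⟩
    rw [hm]
    exact ENNReal.rpow_lt_top_of_nonneg (by norm_num) h2
  have key := fourier_Lp_ae f h1 h2'
  have e : eLpNorm (𝓕 f : ℝ → ℂ) 2 volume = eLpNorm f 2 volume := by
    rw [← eLpNorm_congr_ae key, ← Lp.enorm_toLp h2', ← Lp.enorm_def]
    rw [← ofReal_norm, ← ofReal_norm, Lp.norm_fourier_eq]
  rw [hm, hm] at e
  have := congrArg (fun z : ENNReal => z ^ (2:ℝ)) e
  simp only [← ENNReal.rpow_mul] at this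
  norm_num at this
  exact this.le

lemma plancherel_FT (f : ℝ → ℂ) (hf : AEStronglyMeasurable f) :
    ∫⁻ ξ, ‖FT f ξ‖ₑ ^ 2 ≤ ∫⁻ x, ‖f x‖ₑ ^ 2 := by
  refine le_trans (le_of_eq ?_) (plancherel_le f hf)
  have hp : (0:ℝ) < 2 * Real.pi := by positivity
  have hmp := Real.map_volume_mul_left (a := (2 * Real.pi)⁻¹) (by positivity)
  have hm : MeasurableEmbedding (fun x : ℝ => (2 * Real.pi)⁻¹ * x) :=
    (Homeomorph.mulLeft₀ _ (by positivity : (2 * Real.pi)⁻¹ ≠ (0:ℝ))).measurableEmbedding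
  have h := hm.lintegral_map (μ := volume) (fun ξ => ‖FourierTransform.fourier f ξ‖ₑ ^ 2)
  rw [hmp, lintegral_smul_measure, inv_inv, abs_of_pos hp] at h
  have : ∀ ξ, ‖FT f ξ‖ₑ ^ 2 = ENNReal.ofReal ((2 * Real.pi)⁻¹) *
      ‖FourierTransform.fourier f ((2 * Real.pi)⁻¹ * ξ)‖ₑ ^ 2 := by
    intro ξ
    rw [FT_eq_fourier, enorm_mul, mul_pow, div_eq_inv_mul]
    congr 1
    rw [← ofReal_norm, ← ENNReal.ofReal_pow (norm_nonneg _)]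
    congr 1
    rw [norm_inv, Complex.norm_real, Real.norm_of_nonneg (Real.sqrt_nonneg _), inv_pow,
      Real.sq_sqrt hp.le]
  simp_rw [this]
  rw [lintegral_const_mul' _ _ ENNReal.ofReal_ne_top, ← h, smul_eq_mul, ← mul_assoc,
    ← ENNReal.ofReal_mul (by positivity), inv_mul_cancel₀ hp.ne']
  simp

lemma htg_jb : (fun ξ : ℝ => ((Real.sqrt (1 + ξ ^ 2) : ℝ) : ℂ)).HasTemperateGrowth := by
  have h := Function.hasTemperateGrowth_one_add_norm_sq_rpow ℝ (1/2 : ℝ)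
  have h2 := Function.HasTemperateGrowth.comp Function.Complex.hasTemperateGrowth_ofReal h
  have e : (fun ξ : ℝ => ((Real.sqrt (1 + ξ ^ 2) : ℝ) : ℂ)) =
      Complex.ofReal ∘ fun x : ℝ => (1 + ‖x‖ ^ 2) ^ (1 / 2 : ℝ) := by
    ext ξ
    simp [Real.sqrt_eq_rpow]
  rw [e]
  exact h2

lemma htg_poly : (fun ξ : ℝ => ((1 + ξ ^ 2 : ℝ) : ℂ)).HasTemperateGrowth := by
  have h := Function.hasTemperateGrowth_one_add_norm_sq_rpow ℝ (1 : ℝ)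
  have h2 := Function.HasTemperateGrowth.comp Function.Complex.hasTemperateGrowth_ofReal h
  have e : (fun ξ : ℝ => ((1 + ξ ^ 2 : ℝ) : ℂ)) =
      Complex.ofReal ∘ fun x : ℝ => (1 + ‖x‖ ^ 2) ^ (1 : ℝ) := by
    ext ξ
    simp
  rw [e]
  exact h2

/-- scaling by `(2π)⁻¹` -/
def scl : ℝ ≃L[ℝ] ℝ :=
  ContinuousLinearEquiv.smulLeft (Units.mk0 ((2 * Real.pi)⁻¹ : ℝ) (by positivity))

lemma scl_apply (x : ℝ) : scl x = x / (2 * Real.pi) := by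
  rw [div_eq_inv_mul]
  rfl

open FourierTransform SchwartzMap in
lemma jbD_props (f : ℝ → ℂ) (hs : ContDiff ℝ (⊤ : ℕ∞) f)
    (hd : ∀ k n : ℕ, ∃ B : ℝ, ∀ x : ℝ, |x| ^ k * ‖iteratedDeriv n f x‖ ≤ B) :
    Integrable (fun x : ℝ => ‖((1 + x ^ 2 : ℝ) : ℂ) * jbD f x‖ ^ 2) ∧
    ∀ ξ, FT (jbD f) ξ = ((Real.sqrt (1 + ξ ^ 2) : ℝ) : ℂ) * FT f ξ := by
  let c : ℂ := (Real.sqrt (2 * Real.pi) : ℂ)⁻¹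
  have hc : c * c * ((2 * Real.pi : ℝ) : ℂ) = 1 := by
    have hp : (0:ℝ) < 2 * Real.pi := by positivity
    have : ((Real.sqrt (2 * Real.pi) : ℝ) : ℂ) * ((Real.sqrt (2 * Real.pi) : ℝ) : ℂ)
      = ((2 * Real.pi : ℝ) : ℂ) := by
      rw [← Complex.ofReal_mul, Real.mul_self_sqrt hp.le]
    rw [← this]
    have h0 : ((Real.sqrt (2 * Real.pi) : ℝ) : ℂ) ≠ 0 := by
      exact_mod_cast (Real.sqrt_pos.2 hp).ne'
    simp only [c]
    field_simp
  let F : 𝓢(ℝ, ℂ) := ⟨f, hs, fun k n => by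
    obtain ⟨B, hB⟩ := hd k n
    refine ⟨B, fun x => ?_⟩
    rw [norm_iteratedFDeriv_eq_norm_iteratedDeriv, Real.norm_eq_abs]
    exact hB x⟩
  let h : 𝓢(ℝ, ℂ) := smulLeftCLM ℂ (fun ξ : ℝ => ((Real.sqrt (1 + ξ ^ 2) : ℝ) : ℂ))
    (c • compCLMOfContinuousLinearEquiv ℂ scl (𝓕 F))
  have hh : ∀ ξ, h ξ = ((Real.sqrt (1 + ξ ^ 2) : ℝ) : ℂ) * FT f ξ := by
    intro ξ
    simp only [h]
    rw [smulLeftCLM_apply_apply htg_jb, FT_eq_fourier]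
    simp only [smul_eq_mul, _root_.smul_apply, compCLMOfContinuousLinearEquiv_apply,
      Function.comp, scl_apply]
    rfl
  let G : 𝓢(ℝ, ℂ) := c • compCLMOfContinuousLinearEquiv ℂ scl (𝓕⁻ h)
  have hG : ∀ x, jbD f x = G x := by
    intro x
    simp only [G, jbD, _root_.smul_apply, compCLMOfContinuousLinearEquiv_apply,
      Function.comp, scl_apply, smul_eq_mul, fourierInv_coe]
    rw [Real.fourierInv_eq']
    congr 2
    ext ξ
    rw [hh, smul_eq_mul, mul_assoc]
    congr 2
    have : (Real.pi : ℂ) ≠ 0 := by exact_mod_cast Real.pi_ne_zero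
    simp
    field_simp
  have hG' : jbD f = G := funext hG
  constructor
  · let K : 𝓢(ℝ, ℂ) := smulLeftCLM ℂ (fun ξ : ℝ => ((1 + ξ ^ 2 : ℝ) : ℂ)) G
    have := (K.memLp 2 volume).integrable_norm_pow (by norm_num)
    convert this using 3 with x
    simp only [K]
    rw [smulLeftCLM_apply_apply htg_poly, hG, smul_eq_mul]
  · intro ξ
    rw [← hh, hG', FT]
    let h' : 𝓢(ℝ, ℂ) := 𝓕⁻ h
    let P : ℝ → ℂ := fun y : ℝ => c * (Complex.exp (↑(-2 * Real.pi * y * ξ) * Complex.I) • h' y)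
    have e1 : ∀ x : ℝ, Complex.exp (-(Complex.I * (x : ℂ) * (ξ : ℂ))) * G x =
        P (x / (2 * Real.pi)) := by
      intro x
      simp only [P, h', G, _root_.smul_apply, compCLMOfContinuousLinearEquiv_apply,
        Function.comp, scl_apply, smul_eq_mul]
      rw [mul_left_comm]
      congr 3
      have : (Real.pi : ℂ) ≠ 0 := by exact_mod_cast Real.pi_ne_zero
      push_cast
      field_simp
    rw [integral_congr_ae (Filter.Eventually.of_forall e1), 
      Measure.integral_comp_div P (2 * Real.pi)]
    simp only [P]
    rw [integral_const_mul, ← Real.fourier_real_eq_integral_exp_smul]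
    rw [← fourier_coe, show 𝓕 h' = h from fourier_fourierInv_eq h, abs_of_pos (by positivity), Complex.real_smul]
    linear_combination h ξ * hc

lemma cs_lint {α : Type*} [MeasurableSpace α] {μ : Measure α} (f : α → ENNReal)
    (hf : AEMeasurable f μ) (u : α → ℝ) (hu : ∀ x, 0 < u x) (hum : Measurable u) :
    (∫⁻ x, f x ∂μ) ^ 2 ≤ (∫⁻ x, ENNReal.ofReal (u x)⁻¹ ∂μ) *
      ∫⁻ x, ENNReal.ofReal (u x) * f x ^ 2 ∂μ := by
  have h := ENNReal.lintegral_mul_le_Lp_mul_Lq μ (p := 2) (q := 2)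
    (Real.HolderConjugate.two_two)
    (f := fun x => ENNReal.ofReal (Real.sqrt (u x))⁻¹)
    (g := fun x => ENNReal.ofReal (Real.sqrt (u x)) * f x) (by fun_prop) (by fun_prop)
  have e : ∀ x, ENNReal.ofReal (Real.sqrt (u x))⁻¹ * (ENNReal.ofReal (Real.sqrt (u x)) * f x)
      = f x := by
    intro x
    rw [← mul_assoc, ← ENNReal.ofReal_mul (by positivity),
      inv_mul_cancel₀ (Real.sqrt_pos.2 (hu x)).ne']
    simp
  have e1 : ∀ x, ENNReal.ofReal (Real.sqrt (u x))⁻¹ ^ (2:ℝ) = ENNReal.ofReal (u x)⁻¹ := by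
    intro x
    rw [ENNReal.rpow_two, ← ENNReal.ofReal_pow (by positivity), inv_pow, Real.sq_sqrt (hu x).le]
  have e2 : ∀ x, (ENNReal.ofReal (Real.sqrt (u x)) * f x) ^ (2:ℝ) =
      ENNReal.ofReal (u x) * f x ^ 2 := by
    intro x
    rw [ENNReal.rpow_two, mul_pow, ← ENNReal.ofReal_pow (by positivity), Real.sq_sqrt (hu x).le]
  simp only [Pi.mul_apply, e, e1, e2] at h
  calc _ ≤ _ := pow_le_pow_left₀ (zero_le) h 2
    _ = _ := by
      rw [mul_pow, ← ENNReal.rpow_two, ← ENNReal.rpow_two, ← ENNReal.rpow_mul, ← ENNReal.rpow_mul]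
      norm_num

lemma cs_int {α : Type*} [MeasurableSpace α] {μ : Measure α} (f : α → ℂ)
    (hf : AEStronglyMeasurable f μ) (u : α → ℝ) (hu : ∀ x, 0 < u x) (hum : Measurable u) :
    ‖∫ x, f x ∂μ‖ₑ ^ 2 ≤ (∫⁻ x, ENNReal.ofReal (u x)⁻¹ ∂μ) *
      ∫⁻ x, ENNReal.ofReal (u x) * ‖f x‖ₑ ^ 2 ∂μ :=
  le_trans (pow_le_pow_left₀ zero_le (enorm_integral_le_lintegral_enorm f) 2)
    (cs_lint _ hf.enorm u hu hum)

lemma lint_inv : ∫⁻ x : ℝ, ENNReal.ofReal (1 + x ^ 2)⁻¹ = ENNReal.ofReal Real.pi := by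
  rw [← integral_univ_inv_one_add_sq, ofReal_integral_eq_lintegral_ofReal]
  · exact integrable_inv_one_add_sq
  · exact Filter.Eventually.of_forall fun x => by positivity

lemma hasDerivAt_jb (x : ℝ) :
    HasDerivAt (fun ξ : ℝ => Real.sqrt (1 + ξ ^ 2)) (x / Real.sqrt (1 + x ^ 2)) x := by
  have h : HasDerivAt (fun ξ : ℝ => 1 + ξ ^ 2) (2 * x) x := by
    simpa using ((hasDerivAt_id x).pow 2).const_add 1
  convert h.sqrt (by positivity) using 1
  have : Real.sqrt (1 + x ^ 2) ≠ 0 := by positivity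
  field_simp

lemma chvar (ψ : ℝ → ENNReal) :
    ∫⁻ ξ : ℝ, ENNReal.ofReal (ξ ^ 2 / (1 + ξ ^ 2)) * ψ (Real.sqrt (1 + ξ ^ 2)) ≤
      2 * ∫⁻ y, ψ y := by
  have key : ∀ S : Set ℝ, MeasurableSet S → Set.InjOn (fun ξ : ℝ => Real.sqrt (1 + ξ ^ 2)) S →
      ∫⁻ ξ in S, ENNReal.ofReal (ξ ^ 2 / (1 + ξ ^ 2)) * ψ (Real.sqrt (1 + ξ ^ 2)) ≤
        ∫⁻ y, ψ y := by
    intro S hS hinj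
    have h := lintegral_image_eq_lintegral_abs_deriv_mul hS
      (fun x _ => (hasDerivAt_jb x).hasDerivWithinAt) hinj ψ
    calc _ ≤ _ := ?_
      _ = _ := h.symm
      _ ≤ _ := setLIntegral_le_lintegral _ _
    refine lintegral_mono fun ξ => ?_
    gcongr
    have h1 : ξ ^ 2 / (1 + ξ ^ 2) = |ξ / Real.sqrt (1 + ξ ^ 2)| ^ 2 := by
      rw [sq_abs, div_pow, Real.sq_sqrt (by positivity)]
    have h2 : |ξ / Real.sqrt (1 + ξ ^ 2)| ≤ 1 := by
      rw [abs_div, abs_of_nonneg (Real.sqrt_nonneg _)]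
      apply div_le_one_of_le₀ _ (Real.sqrt_nonneg _)
      rw [← Real.sqrt_sq_eq_abs]
      exact Real.sqrt_le_sqrt (by linarith)
    rw [h1]
    have h3 := abs_nonneg (ξ / Real.sqrt (1 + ξ ^ 2))
    nlinarith
  rw [← lintegral_add_compl _ (measurableSet_Ioi (a := (0:ℝ))), two_mul]
  refine add_le_add (key _ measurableSet_Ioi ?_) (key _ measurableSet_Ioi.compl ?_)
  · intro x hx y hy hxy
    simp only [Set.mem_Ioi] at hx hy
    have := (Real.sqrt_inj (by positivity) (by positivity)).1 hxy
    nlinarith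
  · intro x hx y hy hxy
    simp only [Set.mem_compl_iff, Set.mem_Ioi, not_lt] at hx hy
    have h := (Real.sqrt_inj (by positivity) (by positivity)).1 hxy
    have : (x - y) * (x + y) = 0 := by linarith
    rcases mul_eq_zero.1 this with h | h <;> linarith

lemma log_bound (t : ℝ) (ht : 0 ≤ t) :
    ∫⁻ s in Set.Ioc 0 t, ENNReal.ofReal ((1 + s ^ 2) * (1 + s ^ 2) ^ (-(3:ℝ)/2)) ≤
      ENNReal.ofReal (2 * Real.log (2 + t)) := by
  have hi : IntervalIntegrable (fun s : ℝ => 2 * (1 + s)⁻¹) volume 0 t := by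
    apply ContinuousOn.intervalIntegrable
    intro s hs
    rw [Set.uIcc_of_le ht] at hs
    have : 1 + s ≠ 0 := by linarith [hs.1]
    exact ContinuousAt.continuousWithinAt (by fun_prop (disch := assumption))
  have hv : ∫ s in (0:ℝ)..t, 2 * (1 + s)⁻¹ = 2 * Real.log (1 + t) := by
    rw [intervalIntegral.integral_const_mul,
      intervalIntegral.integral_comp_add_left (fun s => s⁻¹), integral_inv_of_pos (by simp)
      (by linarith)]
    simp
  calc _ ≤ ∫⁻ s in Set.Ioc 0 t, ENNReal.ofReal (2 * (1 + s)⁻¹) := by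
        refine setLIntegral_mono' measurableSet_Ioc fun s hs => ?_
        apply ENNReal.ofReal_le_ofReal
        have hs0 : 0 < s := hs.1
        have h1 : (0:ℝ) < 1 + s ^ 2 := by positivity
        have e : (1 + s ^ 2) * (1 + s ^ 2) ^ (-(3:ℝ)/2) = (Real.sqrt (1 + s ^ 2))⁻¹ := by
          rw [Real.sqrt_eq_rpow, ← Real.rpow_neg h1.le]
          nth_rewrite 1 [← Real.rpow_one (1 + s ^ 2)]
          rw [← Real.rpow_add h1]
          norm_num
        rw [e]
        have h2 : (1 + s) / 2 ≤ Real.sqrt (1 + s ^ 2) := by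
          apply Real.le_sqrt_of_sq_le
          nlinarith [sq_nonneg (s - 1)]
        calc _ ≤ ((1 + s) / 2)⁻¹ := by gcongr
          _ = _ := by field_simp
    _ = ENNReal.ofReal (∫ s in Set.Ioc 0 t, 2 * (1 + s)⁻¹) := by
        rw [ofReal_integral_eq_lintegral_ofReal]
        · exact (intervalIntegrable_iff_integrableOn_Ioc_of_le ht).1 hi
        · filter_upwards [ae_restrict_mem measurableSet_Ioc] with s hs
          have := hs.1
          positivity
    _ ≤ _ := by
        rw [← intervalIntegral.integral_of_le ht, hv]
        apply ENNReal.ofReal_le_ofReal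
        gcongr
        linarith

lemma enorm_exp_I (z : ℝ) : ‖Complex.exp (-(Complex.I * (z : ℂ)))‖ₑ = 1 := by
  rw [← ofReal_norm, show -(Complex.I * (z:ℂ)) = ((-z : ℝ) : ℂ) * Complex.I by push_cast; ring,
    Complex.norm_exp_ofReal_mul_I]
  simp

lemma enorm_exp_I2 (x ξ : ℝ) : ‖Complex.exp (-(Complex.I * (x : ℂ) * (ξ : ℂ)))‖ₑ = 1 := by
  rw [← enorm_exp_I (x * ξ)]
  push_cast
  rw [mul_assoc]

lemma norm_exp_I (z : ℝ) : ‖Complex.exp (-(Complex.I * (z : ℂ)))‖ = 1 := by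
  rw [show -(Complex.I * (z:ℂ)) = ((-z : ℝ) : ℂ) * Complex.I by push_cast; ring,
    Complex.norm_exp_ofReal_mul_I]

lemma enorm_FT_le (f : ℝ → ℂ) (ξ : ℝ) : ‖FT f ξ‖ₑ ≤ ∫⁻ x, ‖f x‖ₑ := by
  rw [FT, enorm_mul]
  have h1 : ‖(Real.sqrt (2 * Real.pi) : ℂ)⁻¹‖ₑ ≤ 1 := by
    rw [← ofReal_norm, ENNReal.ofReal_le_one, norm_inv, Complex.norm_real,
      Real.norm_of_nonneg (Real.sqrt_nonneg _)]
    apply inv_le_one_of_one_le₀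
    rw [Real.one_le_sqrt]
    linarith [Real.pi_gt_three]
  calc _ ≤ 1 * ‖∫ x : ℝ, Complex.exp (-(Complex.I * (x : ℂ) * (ξ : ℂ))) * f x‖ₑ := by gcongr
    _ ≤ ∫⁻ x : ℝ, ‖Complex.exp (-(Complex.I * (x : ℂ) * (ξ : ℂ))) * f x‖ₑ := by
      rw [one_mul]; exact enorm_integral_le_lintegral_enorm _
    _ = _ := by simp_rw [enorm_mul, enorm_exp_I2, one_mul]

lemma hasDerivAt_FT (f : ℝ → ℂ) (h1 : Integrable f) (h2 : Integrable (fun x : ℝ => (x : ℂ) * f x))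
    (ξ : ℝ) : HasDerivAt (FT f) (FT (fun x => -Complex.I * x * f x) ξ) ξ := by
  have h := Real.hasDerivAt_fourier h1 (by simpa using h2) (ξ / (2 * Real.pi))
  have h3 := (h.scomp ξ ((hasDerivAt_id ξ).div_const (2 * Real.pi))).const_mul
    ((Real.sqrt (2 * Real.pi) : ℂ)⁻¹)
  have e : FT f = fun ξ => (Real.sqrt (2 * Real.pi) : ℂ)⁻¹ *
      (FourierTransform.fourier f ∘ fun ξ : ℝ => id ξ / (2 * Real.pi)) ξ := by
    ext ξ
    rw [FT_eq_fourier]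
    rfl
  rw [e]
  refine HasDerivAt.congr_deriv h3 ?_
  symm
  rw [FT_eq_fourier, Real.fourier_real_eq_integral_exp_smul,
    Real.fourier_real_eq_integral_exp_smul]
  rw [← integral_smul]
  congr 2
  ext x
  simp only [smul_eq_mul, Complex.real_smul]
  have : (Real.pi : ℂ) ≠ 0 := by exact_mod_cast Real.pi_ne_zero
  push_cast
  field_simp

lemma FT_meas (F : ℝ → ℝ → ℂ) (hF : StronglyMeasurable (Function.uncurry F)) :
    StronglyMeasurable (fun p : ℝ × ℝ => FT (F p.1) p.2) := by
  unfold FT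
  refine StronglyMeasurable.const_mul ?_ _
  refine StronglyMeasurable.integral_prod_right (f := fun (p : ℝ × ℝ) (x : ℝ) =>
    Complex.exp (-(Complex.I * (x : ℂ) * (p.2 : ℂ))) * F p.1 x) ?_
  refine StronglyMeasurable.mul ?_ ?_
  · exact Continuous.stronglyMeasurable (by fun_prop)
  · exact hF.comp_measurable (g := fun q : (ℝ × ℝ) × ℝ => (q.1.1, q.2)) (by fun_prop)

lemma jbD_meas (F : ℝ → ℝ → ℂ) (hF : StronglyMeasurable (Function.uncurry F)) :
    StronglyMeasurable (Function.uncurry fun s => jbD (F s)) := by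
  have h := FT_meas F hF
  change StronglyMeasurable (fun p : ℝ × ℝ => jbD (F p.1) p.2)
  unfold jbD
  refine StronglyMeasurable.const_mul ?_ _
  refine StronglyMeasurable.integral_prod_right (f := fun (p : ℝ × ℝ) (ξ : ℝ) =>
    Complex.exp (Complex.I * (p.2 : ℂ) * (ξ : ℂ)) * ((Real.sqrt (1 + ξ ^ 2) : ℝ) : ℂ) *
      FT (F p.1) ξ) ?_
  refine StronglyMeasurable.mul ?_ ?_
  · exact Continuous.stronglyMeasurable (by fun_prop)
  · exact h.comp_measurable (g := fun q : (ℝ × ℝ) × ℝ => (q.1.1, q.2)) (by fun_prop)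

lemma enorm_sq_le {x y : ℂ} (h : ‖x‖ ≤ ‖y‖) : ‖x‖ₑ ^ 2 ≤ ‖y‖ₑ ^ 2 := by
  rw [← ofReal_norm, ← ofReal_norm]
  gcongr

lemma enorm_add_sq (x y : ℂ) : ‖x + y‖ₑ ^ 2 ≤ 2 * ‖x‖ₑ ^ 2 + 2 * ‖y‖ₑ ^ 2 := by
  rw [← ofReal_norm, ← ofReal_norm, ← ofReal_norm, ← ENNReal.ofReal_pow (norm_nonneg _),
    ← ENNReal.ofReal_pow (norm_nonneg _), ← ENNReal.ofReal_pow (norm_nonneg _),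
    show (2 : ENNReal) = ENNReal.ofReal 2 by simp, ← ENNReal.ofReal_mul (by norm_num),
    ← ENNReal.ofReal_mul (by norm_num), ← ENNReal.ofReal_add (by positivity) (by positivity)]
  apply ENNReal.ofReal_le_ofReal
  have h := norm_add_le x y
  have h0 := norm_nonneg (x + y)
  nlinarith [sq_nonneg (‖x‖ - ‖y‖)]

lemma norm_one_add_sq (x : ℝ) : ‖((1 + x ^ 2 : ℝ) : ℂ)‖ = 1 + x ^ 2 := by
  rw [Complex.norm_real, Real.norm_of_nonneg (by positivity)]

lemma moments (f : ℝ → ℂ) (hf : AEStronglyMeasurable f) (a : ℝ) (ha : 0 ≤ a)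
    (hW : ∫⁻ x : ℝ, ‖((1 + x ^ 2 : ℝ) : ℂ) * f x‖ₑ ^ 2 ≤ ENNReal.ofReal (a ^ 2)) :
    (∫⁻ x, ‖f x‖ₑ ≤ ENNReal.ofReal (2 * a)) ∧
    (∫⁻ x : ℝ, ‖(x : ℂ) * f x‖ₑ ≤ ENNReal.ofReal (2 * a)) := by
  have key : ∀ g : ℝ → ℂ, AEStronglyMeasurable g →
      (∀ x, ‖g x‖ ≤ Real.sqrt (1 + x ^ 2) * ‖f x‖) →
      ∫⁻ x, ‖g x‖ₑ ≤ ENNReal.ofReal (2 * a) := by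
    intro g hg hgf
    have h := cs_lint (fun x => ‖g x‖ₑ) hg.enorm (fun x : ℝ => 1 + x ^ 2)
      (fun x => by positivity) (by fun_prop)
    rw [lint_inv] at h
    have h2 : ∫⁻ x : ℝ, ENNReal.ofReal (1 + x ^ 2) * ‖g x‖ₑ ^ 2 ≤ ENNReal.ofReal (a ^ 2) := by
      refine le_trans (lintegral_mono fun x => ?_) hW
      rw [← ofReal_norm, ← ofReal_norm, ← ENNReal.ofReal_pow (norm_nonneg _),
        ← ENNReal.ofReal_pow (norm_nonneg _), ← ENNReal.ofReal_mul (by positivity)]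
      apply ENNReal.ofReal_le_ofReal
      rw [norm_mul, norm_one_add_sq]
      have h3 := pow_le_pow_left₀ (norm_nonneg _) (hgf x) 2
      rw [mul_pow, Real.sq_sqrt (by positivity)] at h3
      calc _ ≤ (1 + x ^ 2) * ((1 + x ^ 2) * ‖f x‖ ^ 2) := by gcongr
        _ = _ := by ring
    have h3 : (∫⁻ x, ‖g x‖ₑ) ^ 2 ≤ ENNReal.ofReal (2 * a) ^ 2 := by
      refine h.trans ?_
      calc _ ≤ ENNReal.ofReal Real.pi * ENNReal.ofReal (a ^ 2) := by gcongr
        _ ≤ _ := by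
          rw [← ENNReal.ofReal_mul Real.pi_pos.le, ← ENNReal.ofReal_pow (by positivity)]
          apply ENNReal.ofReal_le_ofReal
          nlinarith [Real.pi_lt_four, sq_nonneg a]
    exact (ENNReal.pow_le_pow_left_iff two_ne_zero).1 h3
  constructor
  · refine key f hf fun x => ?_
    have : 1 ≤ Real.sqrt (1 + x ^ 2) := by rw [Real.one_le_sqrt]; nlinarith [sq_nonneg x]
    nlinarith [norm_nonneg (f x)]
  · refine key _ ((Complex.continuous_ofReal.aestronglyMeasurable).mul hf) fun x => ?_
    rw [norm_mul, Complex.norm_real, Real.norm_eq_abs]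
    gcongr
    rw [← Real.sqrt_sq_eq_abs]
    exact Real.sqrt_le_sqrt (by linarith)

lemma wsum (F : ℝ → ℝ → ℂ) (a t : ℝ) (ht : 0 ≤ t)
    (hW : ∀ s ∈ Set.Ioc 0 t, ∫⁻ x : ℝ, ‖((1 + x ^ 2 : ℝ) : ℂ) * F s x‖ₑ ^ 2 ≤
      ENNReal.ofReal (a ^ 2 * (1 + s ^ 2) ^ (-(3:ℝ)/2))) :
    ∫⁻ s in Set.Ioc 0 t, ENNReal.ofReal (1 + s ^ 2) *
      ∫⁻ x : ℝ, ‖((1 + x ^ 2 : ℝ) : ℂ) * F s x‖ₑ ^ 2 ≤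
      ENNReal.ofReal (2 * a ^ 2 * Real.log (2 + t)) := by
  calc _ ≤ ∫⁻ s in Set.Ioc 0 t, ENNReal.ofReal (a ^ 2) *
        ENNReal.ofReal ((1 + s ^ 2) * (1 + s ^ 2) ^ (-(3:ℝ)/2)) := by
        refine setLIntegral_mono' measurableSet_Ioc fun s hs => ?_
        refine (mul_le_mul_right (hW s hs) _).trans (le_of_eq ?_)
        rw [← ENNReal.ofReal_mul (by positivity), ← ENNReal.ofReal_mul (by positivity)]
        congr 1
        ring
    _ ≤ ENNReal.ofReal (a ^ 2) * ENNReal.ofReal (2 * Real.log (2 + t)) := by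
        rw [lintegral_const_mul' _ _ ENNReal.ofReal_ne_top]
        gcongr
        exact log_bound t ht
    _ = _ := by
        rw [← ENNReal.ofReal_mul (by positivity)]
        congr 1
        ring

lemma lint_inv_le (t : ℝ) : ∫⁻ s in Set.Ioc 0 t, ENNReal.ofReal (1 + s ^ 2)⁻¹ ≤
    ENNReal.ofReal Real.pi := by
  rw [← lint_inv]
  exact setLIntegral_le_lintegral _ _

lemma FT_enorm_meas (F : ℝ → ℝ → ℂ) (hF : StronglyMeasurable (Function.uncurry F)) :
    Measurable fun p : ℝ × ℝ => ‖FT (F p.2) p.1‖ₑ := by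
  have h := (FT_meas F hF).enorm
  exact h.comp (g := fun q : ℝ × ℝ => ‖FT (F q.1) q.2‖ₑ) (f := fun p : ℝ × ℝ => (p.2, p.1))
    (by fun_prop)

lemma FT_enorm_meas_left (F : ℝ → ℝ → ℂ) (hF : StronglyMeasurable (Function.uncurry F)) (s : ℝ) :
    Measurable fun ξ : ℝ => ‖FT (F s) ξ‖ₑ := by
  have h := (FT_meas F hF).enorm
  exact h.comp (g := fun q : ℝ × ℝ => ‖FT (F q.1) q.2‖ₑ) (f := fun p : ℝ => (s, p))
    (by fun_prop)

lemma term1 (F : ℝ → ℝ → ℂ) (hF : StronglyMeasurable (Function.uncurry F)) (a t : ℝ) (ht : 0 ≤ t)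
    (hW : ∀ s ∈ Set.Ioc 0 t, ∫⁻ x : ℝ, ‖((1 + x ^ 2 : ℝ) : ℂ) * F s x‖ₑ ^ 2 ≤
      ENNReal.ofReal (a ^ 2 * (1 + s ^ 2) ^ (-(3:ℝ)/2)))
    (q : ℝ → ℝ → ℂ) (hq : ∀ ξ, StronglyMeasurable (q ξ))
    (hb : ∀ ξ s, ‖q ξ s‖ₑ ^ 2 ≤ ‖FT (F s) ξ‖ₑ ^ 2 +
      ‖FT (fun x => -Complex.I * x * F s x) ξ‖ₑ ^ 2) :
    ∫⁻ ξ : ℝ, ‖∫ s in Set.Ioc 0 t, q ξ s‖ₑ ^ 2 ≤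
      ENNReal.ofReal Real.pi * (2 * ENNReal.ofReal (2 * a ^ 2 * Real.log (2 + t))) := by
  have hF2 : StronglyMeasurable (Function.uncurry fun (s x : ℝ) => -Complex.I * x * F s x) := by
    refine StronglyMeasurable.mul ?_ hF
    exact Continuous.stronglyMeasurable (by fun_prop)
  have hFs : ∀ s, StronglyMeasurable (F s) := fun s => hF.comp_measurable (g := fun x => (s, x))
    (by fun_prop)
  have hF2s : ∀ s : ℝ, StronglyMeasurable (fun x : ℝ => -Complex.I * x * F s x) :=
    fun s => hF2.comp_measurable (g := fun x => (s, x)) (by fun_prop)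
  set E : ℝ → ℝ → ENNReal := fun ξ s => ENNReal.ofReal (1 + s ^ 2) * (‖FT (F s) ξ‖ₑ ^ 2 +
      ‖FT (fun x => -Complex.I * x * F s x) ξ‖ₑ ^ 2) with hE
  have hEm : Measurable (Function.uncurry E) := by
    have h1 : Measurable fun p : ℝ × ℝ => ‖FT (F p.2) p.1‖ₑ := FT_enorm_meas F hF
    have h2 : Measurable fun p : ℝ × ℝ => ‖FT (fun x => -Complex.I * x * F p.2 x) p.1‖ₑ :=
      FT_enorm_meas (fun (s x : ℝ) => -Complex.I * x * F s x) hF2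
    have h3 : Measurable fun p : ℝ × ℝ => ENNReal.ofReal (1 + p.2 ^ 2) := by fun_prop
    exact h3.mul ((h1.pow_const 2).add (h2.pow_const 2))
  calc _ ≤ ∫⁻ ξ : ℝ, ENNReal.ofReal Real.pi * ∫⁻ s in Set.Ioc 0 t, E ξ s := by
        refine lintegral_mono fun ξ => ?_
        refine (cs_int (q ξ) (hq ξ).aestronglyMeasurable (fun s : ℝ => 1 + s ^ 2)
          (fun s => by positivity) (by fun_prop)).trans ?_
        refine mul_le_mul' (lint_inv_le t) (lintegral_mono fun s => ?_)
        exact mul_le_mul_right (hb ξ s) _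
    _ = ENNReal.ofReal Real.pi * ∫⁻ s in Set.Ioc 0 t, ∫⁻ ξ : ℝ, E ξ s := by
        rw [lintegral_const_mul' _ _ ENNReal.ofReal_ne_top, lintegral_lintegral_swap]
        exact hEm.aemeasurable
    _ ≤ ENNReal.ofReal Real.pi * ∫⁻ s in Set.Ioc 0 t, 2 * (ENNReal.ofReal (1 + s ^ 2) *
          ∫⁻ x : ℝ, ‖((1 + x ^ 2 : ℝ) : ℂ) * F s x‖ₑ ^ 2) := by
        refine mul_le_mul_right (lintegral_mono fun s => ?_) _
        simp only [hE]
        have hms : Measurable fun ξ : ℝ => ‖FT (F s) ξ‖ₑ ^ 2 :=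
          (FT_enorm_meas_left F hF s).pow_const 2
        rw [lintegral_const_mul' _ _ ENNReal.ofReal_ne_top, lintegral_add_left hms, mul_left_comm]
        refine mul_le_mul_right ?_ _
        rw [two_mul]
        refine add_le_add ?_ ?_
        · refine (plancherel_FT _ (hFs s).aestronglyMeasurable).trans (lintegral_mono fun x => ?_)
          apply enorm_sq_le
          rw [norm_mul, norm_one_add_sq]
          nlinarith [norm_nonneg (F s x), sq_nonneg x, mul_nonneg (norm_nonneg (F s x)) (sq_nonneg x)]
        · refine (plancherel_FT _ (hF2s s).aestronglyMeasurable).trans (lintegral_mono fun x => ?_)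
          apply enorm_sq_le
          rw [norm_mul, norm_mul, norm_mul, norm_one_add_sq, norm_neg, Complex.norm_I, one_mul,
            Complex.norm_real, Real.norm_eq_abs]
          gcongr
          nlinarith [sq_nonneg (|x| - 1), sq_abs x]
    _ ≤ _ := by
        rw [lintegral_const_mul' _ _ (by norm_num)]
        refine mul_le_mul_right (mul_le_mul_right (wsum F a t ht hW) _) _

lemma term2 (F : ℝ → ℝ → ℂ) (hF : StronglyMeasurable (Function.uncurry F)) (a t : ℝ) (ht : 0 ≤ t)
    (ha : 0 ≤ a)
    (hW : ∀ s ∈ Set.Ioc 0 t, ∫⁻ x : ℝ, ‖((1 + x ^ 2 : ℝ) : ℂ) * F s x‖ₑ ^ 2 ≤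
      ENNReal.ofReal (a ^ 2 * (1 + s ^ 2) ^ (-(3:ℝ)/2)))
    (hB : ∀ s ∈ Set.Ioc 0 t, ∫⁻ x : ℝ, ‖F s x‖ₑ ≤ ENNReal.ofReal (2 * a)) :
    ∫⁻ ξ : ℝ, ENNReal.ofReal (ξ ^ 2 / (1 + ξ ^ 2)) * ‖∫ s in Set.Ioc 0 t,
        (s : ℂ) * Complex.exp (-(Complex.I * ((s * Real.sqrt (1 + ξ ^ 2) : ℝ) : ℂ))) *
          FT (F s) ξ‖ₑ ^ 2 ≤
      ENNReal.ofReal Real.pi * (2 * ENNReal.ofReal (2 * a ^ 2 * Real.log (2 + t))) := by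
  set ψ : ℝ → ℝ → ℂ := fun x s => (Set.Ioc 0 t).indicator (fun s : ℝ => (s : ℂ) * F s x) s with hψ
  have hFsw : StronglyMeasurable (fun p : ℝ × ℝ => F p.2 p.1) := hF.comp_measurable measurable_swap
  have hψm : StronglyMeasurable (Function.uncurry ψ) := by
    have h1 : StronglyMeasurable (fun p : ℝ × ℝ => (p.2 : ℂ) * F p.2 p.1) :=
      (Continuous.stronglyMeasurable (by fun_prop)).mul hFsw
    have h2 := h1.indicator (s := Prod.snd ⁻¹' (Set.Ioc 0 t)) (measurable_snd measurableSet_Ioc)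
    convert h2 using 1
    ext ⟨x, s⟩
    simp only [hψ, Function.uncurry, Set.indicator, Set.mem_preimage]
  have hψs : ∀ x, StronglyMeasurable (ψ x) := fun x => hψm.comp_measurable (g := fun s => (x, s))
    (by fun_prop)
  have hm := FT_meas ψ hψm
  have fub : ∀ ξ : ℝ, ∫ s in Set.Ioc 0 t,
        (s : ℂ) * Complex.exp (-(Complex.I * ((s * Real.sqrt (1 + ξ ^ 2) : ℝ) : ℂ))) *
          FT (F s) ξ = ∫ x : ℝ, Complex.exp (-(Complex.I * (x : ℂ) * (ξ : ℂ))) *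
            FT (ψ x) (Real.sqrt (1 + ξ ^ 2)) := by
    intro ξ
    set l := Real.sqrt (1 + ξ ^ 2)
    set c := (Real.sqrt (2 * Real.pi) : ℂ)⁻¹ with hc
    set K : ℝ → ℝ → ℂ := fun s x => (s : ℂ) * Complex.exp (-(Complex.I * ((s * l : ℝ) : ℂ))) *
      (c * (Complex.exp (-(Complex.I * (x : ℂ) * (ξ : ℂ))) * F s x)) with hK
    have hKm : StronglyMeasurable (Function.uncurry K) := by
      refine StronglyMeasurable.mul (Continuous.stronglyMeasurable (by fun_prop)) ?_
      refine StronglyMeasurable.mul stronglyMeasurable_const ?_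
      exact StronglyMeasurable.mul (Continuous.stronglyMeasurable (by fun_prop)) hF
    have hKi : Integrable (Function.uncurry K) ((volume.restrict (Set.Ioc 0 t)).prod volume) := by
      refine ⟨hKm.aestronglyMeasurable, ?_⟩
      rw [hasFiniteIntegral_iff_enorm, lintegral_prod _ (hKm.enorm.aemeasurable)]
      calc _ ≤ ∫⁻ s in Set.Ioc 0 t, ENNReal.ofReal t * (‖c‖ₑ * ENNReal.ofReal (2 * a)) := by
            refine setLIntegral_mono' measurableSet_Ioc fun s hs => ?_
            simp only [Function.uncurry, hK, enorm_mul, enorm_exp_I, enorm_exp_I2, one_mul, mul_one]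
            rw [lintegral_const_mul' _ _ (by simp), lintegral_const_mul' _ _ (by simp)]
            refine mul_le_mul' ?_ (mul_le_mul_right (hB s hs) _)
            rw [← ofReal_norm, Complex.norm_real, Real.norm_of_nonneg hs.1.le]
            exact ENNReal.ofReal_le_ofReal hs.2
        _ < ⊤ := by
            rw [setLIntegral_const]
            refine ENNReal.mul_lt_top (ENNReal.mul_lt_top (by simp) (ENNReal.mul_lt_top ?_ ENNReal.ofReal_lt_top))
              (by simp)
            exact enorm_lt_top
    have sw := integral_integral_swap hKi
    calc _ = ∫ s in Set.Ioc 0 t, ∫ x : ℝ, K s x := by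
          refine integral_congr_ae (Filter.Eventually.of_forall fun s => ?_)
          simp only [hK]
          rw [integral_const_mul, integral_const_mul, FT]
      _ = _ := sw
      _ = _ := by
          refine integral_congr_ae (Filter.Eventually.of_forall fun x => ?_)
          simp only [hK, FT, hψ, ← hc]
          rw [← integral_indicator measurableSet_Ioc, ← integral_const_mul, ← integral_const_mul]
          refine integral_congr_ae (Filter.Eventually.of_forall fun s => ?_)
          by_cases hs : s ∈ Set.Ioc 0 t
          · simp only [Set.indicator_of_mem hs]
            push_cast
            ring_nf
          · simp only [Set.indicator_of_notMem hs, mul_zero]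
  set E : ℝ → ℝ → ENNReal := fun ξ x => ENNReal.ofReal (1 + x ^ 2) *
    (ENNReal.ofReal (ξ ^ 2 / (1 + ξ ^ 2)) * ‖FT (ψ x) (Real.sqrt (1 + ξ ^ 2))‖ₑ ^ 2) with hE
  have hEm : Measurable (Function.uncurry E) := by
    have h1 : Measurable fun p : ℝ × ℝ => ‖FT (ψ p.2) (Real.sqrt (1 + p.1 ^ 2))‖ₑ :=
      (hm.enorm).comp (g := fun q : ℝ × ℝ => ‖FT (ψ q.1) q.2‖ₑ)
        (f := fun p : ℝ × ℝ => (p.2, Real.sqrt (1 + p.1 ^ 2))) (by fun_prop)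
    have h3 : Measurable fun p : ℝ × ℝ => ENNReal.ofReal (1 + p.2 ^ 2) := by fun_prop
    have h4 : Measurable fun p : ℝ × ℝ => ENNReal.ofReal (p.1 ^ 2 / (1 + p.1 ^ 2)) := by fun_prop
    exact h3.mul (h4.mul (h1.pow_const 2))
  calc _ ≤ ∫⁻ ξ : ℝ, ENNReal.ofReal Real.pi * ∫⁻ x : ℝ, E ξ x := by
        refine lintegral_mono fun ξ => ?_
        simp only
        rw [fub ξ]
        have hmx : AEStronglyMeasurable (fun x : ℝ => Complex.exp (-(Complex.I * (x : ℂ) * (ξ : ℂ))) *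
            FT (ψ x) (Real.sqrt (1 + ξ ^ 2))) volume := by
          refine StronglyMeasurable.aestronglyMeasurable ?_
          refine StronglyMeasurable.mul (Continuous.stronglyMeasurable (by fun_prop)) ?_
          exact hm.comp_measurable (g := fun x : ℝ => (x, Real.sqrt (1 + ξ ^ 2))) (by fun_prop)
        refine (mul_le_mul_right (cs_int _ hmx (fun s : ℝ => 1 + s ^ 2)
          (fun s => by positivity) (by fun_prop)) _).trans (le_of_eq ?_)
        rw [lint_inv, mul_left_comm, ← lintegral_const_mul' _ _ ENNReal.ofReal_ne_top]
        congr 1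
        refine lintegral_congr fun x => ?_
        simp only [hE]
        rw [enorm_mul, enorm_exp_I2, one_mul, mul_left_comm]
    _ = ENNReal.ofReal Real.pi * ∫⁻ x : ℝ, ∫⁻ ξ : ℝ, E ξ x := by
        rw [lintegral_const_mul' _ _ ENNReal.ofReal_ne_top, lintegral_lintegral_swap]
        exact hEm.aemeasurable
    _ ≤ ENNReal.ofReal Real.pi * ∫⁻ x : ℝ, 2 * (ENNReal.ofReal (1 + x ^ 2) *
          ∫⁻ s : ℝ, ‖ψ x s‖ₑ ^ 2) := by
        refine mul_le_mul_right (lintegral_mono fun x => ?_) _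
        simp only [hE]
        rw [lintegral_const_mul' _ _ ENNReal.ofReal_ne_top, mul_left_comm 2]
        refine mul_le_mul_right ?_ _
        refine (chvar (fun y => ‖FT (ψ x) y‖ₑ ^ 2)).trans ?_
        exact mul_le_mul_right (plancherel_FT _ (hψs x).aestronglyMeasurable) _
    _ = ENNReal.ofReal Real.pi * (2 * ∫⁻ s : ℝ, ∫⁻ x : ℝ, ENNReal.ofReal (1 + x ^ 2) *
          ‖ψ x s‖ₑ ^ 2) := by
        rw [lintegral_const_mul' _ _ (by norm_num), lintegral_lintegral_swap]
        · simp_rw [lintegral_const_mul' _ _ ENNReal.ofReal_ne_top]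
        · have h1 : Measurable fun p : ℝ × ℝ => ‖ψ p.2 p.1‖ₑ := (hψm.enorm).comp measurable_swap
          have h3 : Measurable fun p : ℝ × ℝ => ENNReal.ofReal (1 + p.2 ^ 2) := by fun_prop
          exact (h3.mul (h1.pow_const 2)).aemeasurable
    _ ≤ ENNReal.ofReal Real.pi * (2 * ∫⁻ s in Set.Ioc 0 t, ENNReal.ofReal (1 + s ^ 2) *
      ∫⁻ x : ℝ, ‖((1 + x ^ 2 : ℝ) : ℂ) * F s x‖ₑ ^ 2) := by
        refine mul_le_mul_right (mul_le_mul_right ?_ _) _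
        rw [← lintegral_indicator measurableSet_Ioc]
        refine lintegral_mono fun s => ?_
        by_cases hs : s ∈ Set.Ioc 0 t
        · simp only [hψ, Set.indicator_of_mem hs]
          rw [← lintegral_const_mul' _ _ ENNReal.ofReal_ne_top]
          refine lintegral_mono fun x => ?_
          simp only
          rw [← ofReal_norm, ← ofReal_norm, ← ENNReal.ofReal_pow (norm_nonneg _),
            ← ENNReal.ofReal_pow (norm_nonneg _), ← ENNReal.ofReal_mul (by positivity),
            ← ENNReal.ofReal_mul (by positivity)]
          apply ENNReal.ofReal_le_ofReal
          rw [norm_mul, norm_mul, norm_one_add_sq, Complex.norm_real, mul_pow, mul_pow,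
            Real.norm_eq_abs, sq_abs, mul_left_comm]
          have h1 : s ^ 2 ≤ 1 + s ^ 2 := by linarith
          have h2 : 1 + x ^ 2 ≤ (1 + x ^ 2) ^ 2 := by nlinarith [sq_nonneg x]
          gcongr
        · simp only [hψ, Set.indicator_of_notMem hs]
          simp
    _ ≤ _ := by
        refine mul_le_mul_right (mul_le_mul_right (wsum F a t ht hW) _) _

lemma P_deriv (s : ℝ) (G : ℝ → ℂ) (G' : ℂ) (ξ : ℝ) (hG : HasDerivAt G G' ξ) :
    HasDerivAt (fun ζ : ℝ => (2 * Complex.I)⁻¹ * ((1 + ζ ^ 2 : ℝ) : ℂ)⁻¹ *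
      Complex.exp (-(Complex.I * ((s * Real.sqrt (1 + ζ ^ 2) : ℝ) : ℂ))) * G ζ)
      (((1 + ξ ^ 2 : ℝ) : ℂ)⁻¹ * ((2 * Complex.I)⁻¹ *
        Complex.exp (-(Complex.I * ((s * Real.sqrt (1 + ξ ^ 2) : ℝ) : ℂ))) *
          (((-(2 * ξ / (1 + ξ ^ 2)) : ℝ) : ℂ) * G ξ + G') +
        ((-(1 / 2) * (ξ / Real.sqrt (1 + ξ ^ 2)) : ℝ) : ℂ) *
          ((s : ℂ) * Complex.exp (-(Complex.I * ((s * Real.sqrt (1 + ξ ^ 2) : ℝ) : ℂ))) * G ξ))) ξ := by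
  have hpos : (0 : ℝ) < 1 + ξ ^ 2 := by positivity
  have hl : Real.sqrt (1 + ξ ^ 2) ≠ 0 := by positivity
  have h1 : HasDerivAt (fun ζ : ℝ => 1 + ζ ^ 2) (2 * ξ) ξ := by
    simpa using (hasDerivAt_pow 2 ξ).const_add 1
  have h2' : HasDerivAt (fun ζ : ℝ => (((1 + ζ ^ 2)⁻¹ : ℝ) : ℂ))
      ((-(2 * ξ) / (1 + ξ ^ 2) ^ 2 : ℝ) : ℂ) ξ := (h1.inv hpos.ne').ofReal_comp
  have h2 : HasDerivAt (fun ζ : ℝ => ((1 + ζ ^ 2 : ℝ) : ℂ)⁻¹)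
      ((-(2 * ξ) / (1 + ξ ^ 2) ^ 2 : ℝ) : ℂ) ξ := by
    simpa only [Complex.ofReal_inv] using h2'
  have h3 : HasDerivAt (fun ζ : ℝ =>
      Complex.exp (-(Complex.I * ((s * Real.sqrt (1 + ζ ^ 2) : ℝ) : ℂ))))
      (Complex.exp (-(Complex.I * ((s * Real.sqrt (1 + ξ ^ 2) : ℝ) : ℂ))) *
        -(Complex.I * ((s * (ξ / Real.sqrt (1 + ξ ^ 2)) : ℝ) : ℂ))) ξ := ((((hasDerivAt_jb ξ).const_mul s).ofReal_comp).const_mul Complex.I).neg.cexp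
  have h4 := ((h2.const_mul (2 * Complex.I)⁻¹).mul h3).mul hG
  have hc : ((1 + ξ ^ 2 : ℝ) : ℂ) ≠ 0 := by exact_mod_cast hpos.ne'
  have hlc : (Real.sqrt (1 + ξ ^ 2) : ℂ) ≠ 0 := by exact_mod_cast hl
  have h5 : HasDerivAt (fun ζ : ℝ => (2 * Complex.I)⁻¹ * ((1 + ζ ^ 2 : ℝ) : ℂ)⁻¹ *
      Complex.exp (-(Complex.I * ((s * Real.sqrt (1 + ζ ^ 2) : ℝ) : ℂ))) * G ζ) _ ξ := h4
  refine h5.congr_deriv ?_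
  · simp only [Pi.mul_apply]
    generalize Complex.exp (-(Complex.I * ((s * Real.sqrt (1 + ξ ^ 2) : ℝ) : ℂ))) = e
    have hinv : (2 * Complex.I)⁻¹ = -(1 / 2) * Complex.I := by
      rw [mul_inv, Complex.inv_I]; ring
    rw [hinv]
    push_cast at hc ⊢
    field_simp
    ring_nf
    simp only [Complex.I_sq]
    ring

lemma q1_bound (e g g' : ℂ) (he : ‖e‖ = 1) (ξ : ℝ) :
    ‖(2 * Complex.I)⁻¹ * e * (((-(2 * ξ / (1 + ξ ^ 2)) : ℝ) : ℂ) * g + g')‖ ≤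
      (1 / 2) * (‖g‖ + ‖g'‖) := by
  rw [norm_mul, norm_mul, he]
  have h0 : ‖(2 * Complex.I)⁻¹‖ = 1 / 2 := by simp
  rw [h0, mul_one]
  gcongr
  refine (norm_add_le _ _).trans ?_
  gcongr
  rw [norm_mul, Complex.norm_real, norm_neg, Real.norm_eq_abs, abs_div,
    abs_of_pos (show (0 : ℝ) < 1 + ξ ^ 2 by positivity), abs_mul, abs_two]
  have : 2 * |ξ| / (1 + ξ ^ 2) ≤ 1 := by
    rw [div_le_one (by positivity)]
    nlinarith [sq_nonneg (|ξ| - 1), sq_abs ξ]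
  exact mul_le_of_le_one_left (norm_nonneg _) this

lemma q1_bound_sq (e g g' : ℂ) (he : ‖e‖ = 1) (ξ : ℝ) :
    ‖(2 * Complex.I)⁻¹ * e * (((-(2 * ξ / (1 + ξ ^ 2)) : ℝ) : ℂ) * g + g')‖ₑ ^ 2 ≤
      ‖g‖ₑ ^ 2 + ‖g'‖ₑ ^ 2 := by
  have h := q1_bound e g g' he ξ
  have h' := pow_le_pow_left₀ (norm_nonneg _) h 2
  rw [← ofReal_norm, ← ofReal_norm, ← ofReal_norm, ← ENNReal.ofReal_pow (norm_nonneg _),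
    ← ENNReal.ofReal_pow (norm_nonneg _), ← ENNReal.ofReal_pow (norm_nonneg _),
    ← ENNReal.ofReal_add (by positivity) (by positivity)]
  apply ENNReal.ofReal_le_ofReal
  refine h'.trans ?_
  nlinarith [sq_nonneg (‖g‖ - ‖g'‖), sq_nonneg ‖g‖, sq_nonneg ‖g'‖]

lemma core (F : ℝ → ℝ → ℂ) (hF : StronglyMeasurable (Function.uncurry F)) (a t : ℝ) (ht : 0 ≤ t)
    (ha : 0 ≤ a)
    (hW : ∀ s ∈ Set.Ioc 0 t, ∫⁻ x : ℝ, ‖((1 + x ^ 2 : ℝ) : ℂ) * F s x‖ₑ ^ 2 ≤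
      ENNReal.ofReal (a ^ 2 * (1 + s ^ 2) ^ (-(3:ℝ)/2))) :
    ∫⁻ ξ : ℝ, ‖((1 + ξ ^ 2 : ℝ) : ℂ) * deriv (fun ζ : ℝ => ∫ s in Set.Ioc 0 t,
      (2 * Complex.I)⁻¹ * ((1 + ζ ^ 2 : ℝ) : ℂ)⁻¹ *
      Complex.exp (-(Complex.I * ((s * Real.sqrt (1 + ζ ^ 2) : ℝ) : ℂ))) * FT (F s) ζ) ξ‖ₑ ^ 2 ≤
      ENNReal.ofReal (64 * a ^ 2 * Real.log (2 + t)) := by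
  have hFs : ∀ s, StronglyMeasurable (F s) := fun s => hF.comp_measurable (g := fun x => (s, x))
    (by fun_prop)
  have hF2 : StronglyMeasurable (Function.uncurry fun (s x : ℝ) => -Complex.I * x * F s x) := by
    refine StronglyMeasurable.mul ?_ hF
    exact Continuous.stronglyMeasurable (by fun_prop)
  have hmom : ∀ s ∈ Set.Ioc 0 t, (∫⁻ x, ‖F s x‖ₑ ≤ ENNReal.ofReal (2 * a)) ∧
      (∫⁻ x : ℝ, ‖(x : ℂ) * F s x‖ₑ ≤ ENNReal.ofReal (2 * a)) := by
    intro s hs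
    refine moments _ (hFs s).aestronglyMeasurable a ha ((hW s hs).trans ?_)
    apply ENNReal.ofReal_le_ofReal
    refine mul_le_of_le_one_right (sq_nonneg a) ?_
    exact Real.rpow_le_one_of_one_le_of_nonpos (by nlinarith [sq_nonneg s]) (by norm_num)
  have hi1 : ∀ s ∈ Set.Ioc 0 t, Integrable (F s) := fun s hs =>
    ⟨(hFs s).aestronglyMeasurable, lt_of_le_of_lt (hmom s hs).1 ENNReal.ofReal_lt_top⟩
  have hi2 : ∀ s ∈ Set.Ioc 0 t, Integrable (fun x : ℝ => (x : ℂ) * F s x) := fun s hs =>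
    ⟨(Complex.continuous_ofReal.aestronglyMeasurable).mul (hFs s).aestronglyMeasurable,
      lt_of_le_of_lt (hmom s hs).2 ENNReal.ofReal_lt_top⟩
  obtain ⟨g, hg⟩ : ∃ g : ℝ → ℝ → ℂ, g = fun s ξ => FT (F s) ξ := ⟨_, rfl⟩
  obtain ⟨g', hg'⟩ : ∃ g : ℝ → ℝ → ℂ, g = fun s ξ => FT (fun x => -Complex.I * x * F s x) ξ :=
    ⟨_, rfl⟩
  have hgd : ∀ s ∈ Set.Ioc 0 t, ∀ ξ, HasDerivAt (g s) (g' s ξ) ξ := by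
    intro s hs ξ
    rw [hg, hg']
    exact hasDerivAt_FT (F s) (hi1 s hs) (hi2 s hs) ξ
  have hgb : ∀ s ∈ Set.Ioc 0 t, ∀ ξ, ‖g s ξ‖ ≤ 2 * a := by
    intro s hs ξ
    have h : ‖g s ξ‖ₑ ≤ ENNReal.ofReal (2 * a) := by
      rw [hg]
      exact (enorm_FT_le _ _).trans (hmom s hs).1
    rw [← ofReal_norm] at h
    exact (ENNReal.ofReal_le_ofReal_iff (by positivity)).1 h
  have hgb' : ∀ s ∈ Set.Ioc 0 t, ∀ ξ, ‖g' s ξ‖ ≤ 2 * a := by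
    intro s hs ξ
    have h : ‖g' s ξ‖ₑ ≤ ENNReal.ofReal (2 * a) := by
      rw [hg']
      refine (enorm_FT_le _ _).trans (le_trans (le_of_eq ?_) (hmom s hs).2)
      refine lintegral_congr fun x => ?_
      rw [mul_assoc, enorm_mul, enorm_neg, ← ofReal_norm Complex.I]
      simp
    rw [← ofReal_norm] at h
    exact (ENNReal.ofReal_le_ofReal_iff (by positivity)).1 h
  have hgm : ∀ ξ, StronglyMeasurable fun s => g s ξ := by
    intro ξ
    rw [hg]
    exact (FT_meas F hF).comp_measurable (g := fun s : ℝ => (s, ξ)) (by fun_prop)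
  have hgm' : ∀ ξ, StronglyMeasurable fun s => g' s ξ := by
    intro ξ
    rw [hg']
    exact (FT_meas (fun (s x : ℝ) => -Complex.I * x * F s x) hF2).comp_measurable
      (g := fun s : ℝ => (s, ξ)) (by fun_prop)
  obtain ⟨q1, hq1⟩ : ∃ q : ℝ → ℝ → ℂ, q = fun ξ s => (2 * Complex.I)⁻¹ *
        Complex.exp (-(Complex.I * ((s * Real.sqrt (1 + ξ ^ 2) : ℝ) : ℂ))) *
          (((-(2 * ξ / (1 + ξ ^ 2)) : ℝ) : ℂ) * g s ξ + g' s ξ) := ⟨_, rfl⟩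
  obtain ⟨q2, hq2⟩ : ∃ q : ℝ → ℝ → ℂ, q = fun (ξ s : ℝ) =>
      (s : ℂ) * Complex.exp (-(Complex.I * ((s * Real.sqrt (1 + ξ ^ 2) : ℝ) : ℂ))) * g s ξ :=
    ⟨_, rfl⟩
  have hq1m : ∀ ξ, StronglyMeasurable (q1 ξ) := by
    intro ξ
    rw [hq1]
    refine StronglyMeasurable.mul (Continuous.stronglyMeasurable (by fun_prop)) ?_
    exact ((hgm ξ).const_mul _).add (hgm' ξ)
  have hq2m : ∀ ξ, StronglyMeasurable (q2 ξ) := by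
    intro ξ
    rw [hq2]
    exact StronglyMeasurable.mul (Continuous.stronglyMeasurable (by fun_prop)) (hgm ξ)
  have hq1b : ∀ ξ, ∀ s ∈ Set.Ioc 0 t, ‖q1 ξ s‖ ≤ 2 * a := by
    intro ξ s hs
    rw [hq1]
    refine (q1_bound _ _ _ (norm_exp_I _) ξ).trans ?_
    linarith [hgb s hs ξ, hgb' s hs ξ]
  have hq2b : ∀ ξ, ∀ s ∈ Set.Ioc 0 t, ‖q2 ξ s‖ ≤ t * (2 * a) := by
    intro ξ s hs
    rw [hq2]
    simp only
    rw [norm_mul, norm_mul, norm_exp_I, mul_one, Complex.norm_real, Real.norm_of_nonneg hs.1.le]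
    exact mul_le_mul hs.2 (hgb s hs ξ) (norm_nonneg _) ht
  have hq1i : ∀ ξ, IntegrableOn (q1 ξ) (Set.Ioc 0 t) := fun ξ =>
    Measure.integrableOn_of_bounded (by simp) (hq1m ξ).aestronglyMeasurable
      ((ae_restrict_iff' measurableSet_Ioc).2 (Filter.Eventually.of_forall (hq1b ξ)))
  have hq2i : ∀ ξ, IntegrableOn (q2 ξ) (Set.Ioc 0 t) := fun ξ =>
    Measure.integrableOn_of_bounded (by simp) (hq2m ξ).aestronglyMeasurable
      ((ae_restrict_iff' measurableSet_Ioc).2 (Filter.Eventually.of_forall (hq2b ξ)))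
  have hl : ∀ ξ : ℝ, |ξ / Real.sqrt (1 + ξ ^ 2)| ≤ 1 := by
    intro ξ
    rw [abs_div, abs_of_pos (show 0 < Real.sqrt (1 + ξ ^ 2) by positivity),
      div_le_one (by positivity), ← Real.sqrt_sq_eq_abs]
    exact Real.sqrt_le_sqrt (by linarith)
  obtain ⟨P, hP⟩ : ∃ P : ℝ → ℝ → ℂ, P = fun ζ s => (2 * Complex.I)⁻¹ * ((1 + ζ ^ 2 : ℝ) : ℂ)⁻¹ *
      Complex.exp (-(Complex.I * ((s * Real.sqrt (1 + ζ ^ 2) : ℝ) : ℂ))) * g s ζ := ⟨_, rfl⟩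
  obtain ⟨P', hP'⟩ : ∃ P' : ℝ → ℝ → ℂ, P' = fun ξ s => ((1 + ξ ^ 2 : ℝ) : ℂ)⁻¹ * (q1 ξ s +
        ((-(1 / 2) * (ξ / Real.sqrt (1 + ξ ^ 2)) : ℝ) : ℂ) * q2 ξ s) := ⟨_, rfl⟩
  have hinv : ∀ ξ : ℝ, ‖((1 + ξ ^ 2 : ℝ) : ℂ)⁻¹‖ ≤ 1 := by
    intro ξ
    rw [norm_inv, norm_one_add_sq]
    exact inv_le_one_of_one_le₀ (by nlinarith [sq_nonneg ξ])
  have hPm : ∀ ζ, StronglyMeasurable (P ζ) := by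
    intro ζ
    rw [hP]
    exact StronglyMeasurable.mul (Continuous.stronglyMeasurable (by fun_prop)) (hgm ζ)
  have hP'm : ∀ ζ, StronglyMeasurable (P' ζ) := by
    intro ζ
    rw [hP']
    exact ((hq1m ζ).add ((hq2m ζ).const_mul _)).const_mul _
  have hPb : ∀ ζ, ∀ s ∈ Set.Ioc 0 t, ‖P ζ s‖ ≤ 2 * a := by
    intro ζ s hs
    rw [hP]
    simp only
    rw [norm_mul, norm_mul, norm_mul, norm_exp_I, mul_one]
    have h0 : ‖(2 * Complex.I)⁻¹‖ ≤ 1 := by simp; norm_num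
    have h1 : ‖(2 * Complex.I)⁻¹‖ * ‖((1 + ζ ^ 2 : ℝ) : ℂ)⁻¹‖ ≤ 1 :=
      mul_le_one₀ h0 (norm_nonneg _) (hinv ζ)
    exact (mul_le_of_le_one_left (norm_nonneg _) h1).trans (hgb s hs ζ)
  have hP'b : ∀ ζ, ∀ s ∈ Set.Ioc 0 t, ‖P' ζ s‖ ≤ 2 * a + t * (2 * a) := by
    intro ζ s hs
    rw [hP']
    simp only
    rw [norm_mul]
    refine (mul_le_of_le_one_left (norm_nonneg _) (hinv ζ)).trans ((norm_add_le _ _).trans ?_)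
    refine add_le_add (hq1b ζ s hs) ?_
    rw [norm_mul]
    refine (mul_le_of_le_one_left (norm_nonneg _) ?_).trans (hq2b ζ s hs)
    rw [Complex.norm_real, Real.norm_eq_abs, abs_mul]
    have h2 : |(-(1 / 2) : ℝ)| ≤ 1 := by rw [abs_neg, abs_of_pos] <;> norm_num
    exact mul_le_one₀ h2 (abs_nonneg _) (hl ζ)
  have hPd : ∀ s ∈ Set.Ioc 0 t, ∀ ξ, HasDerivAt (fun ζ => P ζ s) (P' ξ s) ξ := by
    intro s hs ξ
    rw [hP, hP', hq1, hq2]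
    exact P_deriv s (g s) (g' s ξ) ξ (hgd s hs ξ)
  have hder : ∀ ξ, deriv (fun ζ => ∫ s in Set.Ioc 0 t, P ζ s) ξ = ∫ s in Set.Ioc 0 t, P' ξ s := by
    intro ξ
    have h := hasDerivAt_integral_of_dominated_loc_of_deriv_le
      (μ := volume.restrict (Set.Ioc 0 t)) (F := P) (F' := P') (x₀ := ξ) (s := Set.univ)
      (bound := fun _ => 2 * a + t * (2 * a)) Filter.univ_mem
      (Filter.Eventually.of_forall fun ζ => (hPm ζ).aestronglyMeasurable)
      (Measure.integrableOn_of_bounded (by simp) (hPm ξ).aestronglyMeasurable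
        ((ae_restrict_iff' measurableSet_Ioc).2 (Filter.Eventually.of_forall (hPb ξ))))
      (hP'm ξ).aestronglyMeasurable
      ((ae_restrict_iff' measurableSet_Ioc).2 (Filter.Eventually.of_forall
        fun s hs ζ _ => hP'b ζ s hs))
      (integrable_const _)
      ((ae_restrict_iff' measurableSet_Ioc).2 (Filter.Eventually.of_forall
        fun s hs ζ _ => hPd s hs ζ))
    exact h.2.deriv
  have hsplit : ∀ ξ, ((1 + ξ ^ 2 : ℝ) : ℂ) * deriv (fun ζ => ∫ s in Set.Ioc 0 t, P ζ s) ξ =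
      (∫ s in Set.Ioc 0 t, q1 ξ s) + ((-(1 / 2) * (ξ / Real.sqrt (1 + ξ ^ 2)) : ℝ) : ℂ) *
        ∫ s in Set.Ioc 0 t, q2 ξ s := by
    intro ξ
    rw [hder, hP']
    have hc : ((1 + ξ ^ 2 : ℝ) : ℂ) ≠ 0 := by
      have : (0 : ℝ) < 1 + ξ ^ 2 := by positivity
      exact_mod_cast this.ne'
    rw [integral_const_mul, mul_inv_cancel_left₀ hc, integral_add (hq1i ξ) ((hq2i ξ).const_mul _),
      integral_const_mul]
  have t1 := term1 F hF a t ht hW q1 hq1m (by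
    intro ξ s
    rw [hq1, hg, hg']
    exact q1_bound_sq _ _ _ (norm_exp_I _) ξ)
  have t2 := term2 F hF a t ht ha hW (fun s hs => (hmom s hs).1)
  have hlog : 0 ≤ Real.log (2 + t) := Real.log_nonneg (by linarith)
  have e0 : ∀ ξ, ‖((1 + ξ ^ 2 : ℝ) : ℂ) * deriv (fun ζ => ∫ s in Set.Ioc 0 t, P ζ s) ξ‖ₑ ^ 2 ≤
      2 * ‖∫ s in Set.Ioc 0 t, q1 ξ s‖ₑ ^ 2 +
      2 * (ENNReal.ofReal (ξ ^ 2 / (1 + ξ ^ 2)) * ‖∫ s in Set.Ioc 0 t, q2 ξ s‖ₑ ^ 2) := by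
    intro ξ
    rw [hsplit]
    refine (enorm_add_sq _ _).trans ?_
    refine add_le_add le_rfl ?_
    refine mul_le_mul_right ?_ _
    rw [enorm_mul, mul_pow]
    refine mul_le_mul_left ?_ _
    rw [← ofReal_norm, ← ENNReal.ofReal_pow (norm_nonneg _), Complex.norm_real, Real.norm_eq_abs,
      sq_abs, mul_pow, div_pow, Real.sq_sqrt (by positivity)]
    apply ENNReal.ofReal_le_ofReal
    have : 0 ≤ ξ ^ 2 / (1 + ξ ^ 2) := by positivity
    nlinarith
  have hm2 : Measurable fun ξ => 2 * ‖∫ s in Set.Ioc 0 t, q1 ξ s‖ₑ ^ 2 := by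
    have h1 : StronglyMeasurable (Function.uncurry q1) := by
      rw [hq1, hg, hg']
      have a1 : StronglyMeasurable fun p : ℝ × ℝ => FT (F p.2) p.1 :=
        (FT_meas F hF).comp_measurable (g := fun p : ℝ × ℝ => (p.2, p.1)) (by fun_prop)
      have a2 : StronglyMeasurable fun p : ℝ × ℝ => FT (fun x => -Complex.I * x * F p.2 x) p.1 :=
        (FT_meas (fun (s x : ℝ) => -Complex.I * x * F s x) hF2).comp_measurable
          (g := fun p : ℝ × ℝ => (p.2, p.1)) (by fun_prop)
      have a3 : StronglyMeasurable fun p : ℝ × ℝ => (2 * Complex.I)⁻¹ *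
        Complex.exp (-(Complex.I * ((p.2 * Real.sqrt (1 + p.1 ^ 2) : ℝ) : ℂ))) :=
        Continuous.stronglyMeasurable (by fun_prop)
      have a4 : StronglyMeasurable fun p : ℝ × ℝ => ((-(2 * p.1 / (1 + p.1 ^ 2)) : ℝ) : ℂ) := by
        apply Measurable.stronglyMeasurable
        fun_prop
      exact a3.mul ((a4.mul a1).add a2)
    have h2 := h1.integral_prod_right (ν := volume.restrict (Set.Ioc 0 t))
    exact (h2.enorm.pow_const 2).const_mul 2
  have hgoal : ∫⁻ ξ : ℝ, ‖((1 + ξ ^ 2 : ℝ) : ℂ) *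
      deriv (fun ζ => ∫ s in Set.Ioc 0 t, P ζ s) ξ‖ₑ ^ 2 ≤
      ENNReal.ofReal (64 * a ^ 2 * Real.log (2 + t)) := by
    refine (lintegral_mono e0).trans ?_
    rw [lintegral_add_left hm2, lintegral_const_mul' _ _ (by norm_num),
      lintegral_const_mul' _ _ (by norm_num)]
    have t2' : ∫⁻ ξ : ℝ, ENNReal.ofReal (ξ ^ 2 / (1 + ξ ^ 2)) * ‖∫ s in Set.Ioc 0 t, q2 ξ s‖ₑ ^ 2
        ≤ ENNReal.ofReal Real.pi * (2 * ENNReal.ofReal (2 * a ^ 2 * Real.log (2 + t))) := by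
      rw [hq2, hg]
      exact t2
    refine (add_le_add (mul_le_mul_right t1 2) (mul_le_mul_right t2' 2)).trans ?_
    rw [show (2 : ENNReal) = ENNReal.ofReal 2 by simp, ← ENNReal.ofReal_mul (by norm_num),
      ← ENNReal.ofReal_mul Real.pi_pos.le, ← ENNReal.ofReal_mul (by norm_num),
      ← ENNReal.ofReal_add (by positivity) (by positivity)]
    apply ENNReal.ofReal_le_ofReal
    have h5 : 0 ≤ a ^ 2 * Real.log (2 + t) := by positivity
    nlinarith [Real.pi_lt_four, mul_le_mul_of_nonneg_right Real.pi_lt_four.le h5]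
  rw [hP, hg] at hgoal
  exact hgoal

/-- Weighted energy estimate with logarithmic growth for the Duhamel contribution of a
spatially localized source term with cubic-type decay. -/
theorem weighted_energy_estimate :
    ∃ C : ℝ, 1 ≤ C ∧
      ∀ T : ℝ, 0 < T →
      ∀ A : ℝ → ℝ, MonotoneOn A (Set.Icc 0 T) → (∀ s ∈ Set.Icc (0 : ℝ) T, 0 ≤ A s) →
      ∀ N : ℝ → ℝ → ℂ,
        ContinuousOn (fun p : ℝ × ℝ => N p.1 p.2) (Set.Icc 0 T ×ˢ (Set.univ : Set ℝ)) →
        (∀ s ∈ Set.Icc (0 : ℝ) T, ContDiff ℝ (⊤ : ℕ∞) (N s)) →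
        (∀ k n : ℕ, ∃ B : ℝ, ∀ s ∈ Set.Icc (0 : ℝ) T, ∀ x : ℝ,
          |x| ^ k * ‖iteratedDeriv n (N s) x‖ ≤ B) →
        (∀ s ∈ Set.Icc (0 : ℝ) T,
          (∫ x : ℝ, ‖((1 + x ^ 2 : ℝ) : ℂ) * jbD (N s) x‖ ^ 2) ^ ((1 : ℝ) / 2)
            ≤ A s * (1 + s ^ 2) ^ (-(3 : ℝ) / 4)) →
        ∀ t ∈ Set.Icc (0 : ℝ) T,
          (∫ ξ : ℝ, ‖((1 + ξ ^ 2 : ℝ) : ℂ) *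
              deriv (fun ζ : ℝ =>
                ∫ s in (0 : ℝ)..t,
                  (2 * Complex.I * ((Real.sqrt (1 + ζ ^ 2) : ℝ) : ℂ))⁻¹ *
                    Complex.exp (-(Complex.I * ((s * Real.sqrt (1 + ζ ^ 2) : ℝ) : ℂ))) *
                    FT (N s) ζ) ξ‖ ^ 2) ^ ((1 : ℝ) / 2) ≤
            C * A t * Real.sqrt (Real.log (2 + t)) := by
  refine ⟨8, by norm_num, ?_⟩
  intro T hT A hA hA0 N hN hNs hNd hNw t ht
  obtain ⟨M, hM⟩ : ∃ M : ℝ → ℝ → ℂ, M = fun s => (Set.Icc 0 T).indicator N s := ⟨_, rfl⟩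
  have hMm : StronglyMeasurable (Function.uncurry M) := by
    classical
    have h := hN.measurable_piecewise (g := fun _ => (0 : ℂ)) continuousOn_const
      (measurableSet_Icc.prod MeasurableSet.univ)
    refine Measurable.stronglyMeasurable ?_
    convert h using 1
    ext ⟨s, x⟩
    rw [hM]
    by_cases hs : s ∈ Set.Icc 0 T
    · have hm : (s, x) ∈ Set.Icc 0 T ×ˢ (Set.univ : Set ℝ) := ⟨hs, Set.mem_univ _⟩
      rw [Set.piecewise_eq_of_mem _ _ _ hm]
      simp only [Function.uncurry, Set.indicator_of_mem hs]
    · have hm : (s, x) ∉ Set.Icc 0 T ×ˢ (Set.univ : Set ℝ) := fun h => hs h.1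
      rw [Set.piecewise_eq_of_notMem _ _ _ hm]
      simp only [Function.uncurry, Set.indicator_of_notMem hs, Pi.zero_apply]
  have hMN : ∀ s ∈ Set.Icc 0 T, M s = N s := by
    intro s hs
    rw [hM]
    exact Set.indicator_of_mem hs N
  obtain ⟨F, hF⟩ : ∃ F : ℝ → ℝ → ℂ, F = fun s => jbD (M s) := ⟨_, rfl⟩
  have hFm : StronglyMeasurable (Function.uncurry F) := by
    rw [hF]
    exact jbD_meas M hMm
  have hprops : ∀ s ∈ Set.Icc 0 T, _ := fun s hs => jbD_props (N s) (hNs s hs)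
    (fun k n => (hNd k n).imp fun B hB x => hB s hs x)
  have hsub : ∀ s ∈ Set.Ioc 0 t, s ∈ Set.Icc 0 T := fun s hs => ⟨hs.1.le, hs.2.trans ht.2⟩
  have ha : 0 ≤ A t := hA0 t ht
  have hW : ∀ s ∈ Set.Ioc 0 t, ∫⁻ x : ℝ, ‖((1 + x ^ 2 : ℝ) : ℂ) * F s x‖ₑ ^ 2 ≤
      ENNReal.ofReal ((A t) ^ 2 * (1 + s ^ 2) ^ (-(3:ℝ)/2)) := by
    intro s hs
    have hsT := hsub s hs
    have h1 := (hprops s hsT).1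
    have e1 : ∫⁻ x : ℝ, ‖((1 + x ^ 2 : ℝ) : ℂ) * F s x‖ₑ ^ 2 =
        ENNReal.ofReal (∫ x : ℝ, ‖((1 + x ^ 2 : ℝ) : ℂ) * jbD (N s) x‖ ^ 2) := by
      rw [ofReal_integral_eq_lintegral_ofReal h1
        (Filter.Eventually.of_forall fun x => by positivity)]
      refine lintegral_congr fun x => ?_
      rw [hF]
      simp only
      rw [hMN s hsT, ENNReal.ofReal_pow (norm_nonneg _), ofReal_norm]
    rw [e1]
    apply ENNReal.ofReal_le_ofReal
    have h2 := hNw s hsT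
    have hI : 0 ≤ ∫ x : ℝ, ‖((1 + x ^ 2 : ℝ) : ℂ) * jbD (N s) x‖ ^ 2 :=
      integral_nonneg fun x => by positivity
    rw [← Real.sqrt_eq_rpow] at h2
    have h3 : A s * (1 + s ^ 2) ^ (-(3 : ℝ) / 4) ≤ A t * (1 + s ^ 2) ^ (-(3 : ℝ) / 4) :=
      mul_le_mul_of_nonneg_right (hA hsT ht hs.2) (by positivity)
    have h4 := pow_le_pow_left₀ (Real.sqrt_nonneg _) (h2.trans h3) 2
    rw [Real.sq_sqrt hI, mul_pow, ← Real.rpow_natCast (_ ^ (-(3 : ℝ) / 4)) 2,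
      ← Real.rpow_mul (by positivity)] at h4
    refine h4.trans (le_of_eq ?_)
    norm_num
  have hcore := core F hFm (A t) t ht.1 ha hW
  have hfun : (fun ζ : ℝ => ∫ s in (0 : ℝ)..t,
                  (2 * Complex.I * ((Real.sqrt (1 + ζ ^ 2) : ℝ) : ℂ))⁻¹ *
                    Complex.exp (-(Complex.I * ((s * Real.sqrt (1 + ζ ^ 2) : ℝ) : ℂ))) *
                    FT (N s) ζ) = (fun ζ : ℝ => ∫ s in Set.Ioc 0 t,
      (2 * Complex.I)⁻¹ * ((1 + ζ ^ 2 : ℝ) : ℂ)⁻¹ *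
      Complex.exp (-(Complex.I * ((s * Real.sqrt (1 + ζ ^ 2) : ℝ) : ℂ))) * FT (F s) ζ) := by
    funext ζ
    rw [intervalIntegral.integral_of_le ht.1]
    refine setIntegral_congr_fun measurableSet_Ioc fun s hs => ?_
    have hsT := hsub s hs
    have hl : ((Real.sqrt (1 + ζ ^ 2) : ℝ) : ℂ) ≠ 0 := by
      have : Real.sqrt (1 + ζ ^ 2) ≠ 0 := by positivity
      exact_mod_cast this
    have hsq : ((1 + ζ ^ 2 : ℝ) : ℂ) = ((Real.sqrt (1 + ζ ^ 2) : ℝ) : ℂ) *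
        ((Real.sqrt (1 + ζ ^ 2) : ℝ) : ℂ) := by
      rw [← Complex.ofReal_mul, Real.mul_self_sqrt (by positivity)]
    have hFT : FT (F s) ζ = ((Real.sqrt (1 + ζ ^ 2) : ℝ) : ℂ) * FT (N s) ζ := by
      rw [hF]
      simp only
      rw [hMN s hsT]
      exact (hprops s hsT).2 ζ
    rw [hFT, hsq, mul_inv, mul_inv _ (((Real.sqrt (1 + ζ ^ 2) : ℝ) : ℂ))]
    field_simp
  rw [hfun, ← Real.sqrt_eq_rpow]
  have hlog : 0 ≤ Real.log (2 + t) := Real.log_nonneg (by linarith [ht.1])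
  have hfin := (enorm_integral_le_lintegral_enorm (fun ξ : ℝ => ‖((1 + ξ ^ 2 : ℝ) : ℂ) *
    deriv (fun ζ : ℝ => ∫ s in Set.Ioc 0 t,
      (2 * Complex.I)⁻¹ * ((1 + ζ ^ 2 : ℝ) : ℂ)⁻¹ *
      Complex.exp (-(Complex.I * ((s * Real.sqrt (1 + ζ ^ 2) : ℝ) : ℂ))) * FT (F s) ζ) ξ‖ ^ 2)
      (μ := volume)).trans (le_trans (le_of_eq (lintegral_congr fun ξ => by
        rw [enorm_pow, enorm_norm])) hcore)
  rw [← ofReal_norm, ENNReal.ofReal_le_ofReal_iff (by positivity)] at hfin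
  have hfin2 := (Real.le_norm_self _).trans hfin
  refine (Real.sqrt_le_sqrt hfin2).trans (le_of_eq ?_)
  rw [show 64 * A t ^ 2 * Real.log (2 + t) = (8 * A t) ^ 2 * Real.log (2 + t) by ring,
    Real.sqrt_mul (by positivity), Real.sqrt_sq (by positivity)]
end
end

section
/- Let 𝔪 : ℝ³ → ℂ be a Schwartz function, and define the trilinear operators T_𝔪⁽ᵃ⁾ and T_𝔪⁽ᵇ⁾ on Schwartz functions f, g, h : ℝ → ℂ by declaring the Fourier transform of T_𝔪⁽ᵃ⁾[f,g,h] to be ξ ↦ ∬_{ℝ²} 𝔪(ξ, ξ₁, ξ₂) f̂(ξ₁) ĝ(ξ₂) ĥ(ξ − ξ₁) dξ₁ dξ₂, and the Fourier transform of T_𝔪⁽ᵇ⁾[f,g,h] to be ξ ↦ ∬_{ℝ²} 𝔪(ξ, ξ₁, ξ₂) f̂(ξ₁) ĝ(ξ₂) ĥ(ξ) dξ₁ dξ₂. Then there exists an absolute constant C such that: (i) for all 1 ≤ p, p₁, p₂ ≤ ∞ with 1/p = 1/p₁ + 1/p₂ (convention 1/∞ = 0) and all Schwartz f, g, h, ‖T_𝔪⁽ᵃ⁾[f,g,h]‖_{L^p(ℝ)}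 ≤ C ‖ℱ⁻¹[𝔪]‖_{L¹(ℝ³)} ‖f‖_{L^{p₁}} ‖g‖_{L^∞} ‖h‖_{L^{p₂}}; (ii) for all 1 ≤ p ≤ ∞ and all Schwartz f, g, h, ‖T_𝔪⁽ᵇ⁾[f,g,h]‖_{L^p(ℝ)} ≤ C ‖ℱ⁻¹[𝔪]‖_{L¹(ℝ³)} ‖f‖_{L^∞} ‖g‖_{L^∞} ‖h‖_{L^p}. -/
open MeasureTheory
open scoped ENNReal

noncomputable section

/-- The trilinear operator `T_𝔪⁽ᵃ⁾[f,g,h]`, with Fourier transform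
`ξ ↦ ∬ 𝔪(ξ,ξ₁,ξ₂) f̂(ξ₁) ĝ(ξ₂) ĥ(ξ−ξ₁) dξ₁ dξ₂`. -/
def TtriA (m : ℝ × ℝ × ℝ → ℂ) (f g h : ℝ → ℂ) (x : ℝ) : ℂ :=
  (Real.sqrt (2 * Real.pi) : ℂ)⁻¹ *
    ∫ ξ : ℝ, Complex.exp (Complex.I * (x : ℂ) * (ξ : ℂ)) *
      ∫ ξ₁ : ℝ, ∫ ξ₂ : ℝ, m (ξ, ξ₁, ξ₂) * FT f ξ₁ * FT g ξ₂ * FT h (ξ - ξ₁)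

/-- The trilinear operator `T_𝔪⁽ᵇ⁾[f,g,h]`, with Fourier transform
`ξ ↦ ∬ 𝔪(ξ,ξ₁,ξ₂) f̂(ξ₁) ĝ(ξ₂) ĥ(ξ) dξ₁ dξ₂`. -/
def TtriB (m : ℝ × ℝ × ℝ → ℂ) (f g h : ℝ → ℂ) (x : ℝ) : ℂ :=
  (Real.sqrt (2 * Real.pi) : ℂ)⁻¹ *
    ∫ ξ : ℝ, Complex.exp (Complex.I * (x : ℂ) * (ξ : ℂ)) *
      ∫ ξ₁ : ℝ, ∫ ξ₂ : ℝ, m (ξ, ξ₁, ξ₂) * FT f ξ₁ * FT g ξ₂ * FT h ξ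

/-- The inverse Fourier transform on `ℝ³`. -/
def Finv3 (m : ℝ × ℝ × ℝ → ℂ) (p : ℝ × ℝ × ℝ) : ℂ :=
  ((Real.sqrt (2 * Real.pi) : ℂ) ^ 3)⁻¹ *
    ∫ q : ℝ × ℝ × ℝ,
      Complex.exp (Complex.I * ((p.1 * q.1 + p.2.1 * q.2.1 + p.2.2 * q.2.2 : ℝ) : ℂ)) * m q

open scoped FourierTransform SchwartzMap RealInnerProductSpace in
lemma schw_inv {V : Type*} [NormedAddCommGroup V] [InnerProductSpace ℝ V] [FiniteDimensional ℝ V]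
    [MeasurableSpace V] [BorelSpace V] (M : SchwartzMap V ℂ) :
    Integrable (fun y : V => ∫ x : V, Complex.exp (-(Complex.I * ((inner ℝ x y : ℝ) : ℂ))) * M x) ∧
    ∀ q : V, ∫ y : V, Complex.exp (Complex.I * ((inner ℝ q y : ℝ) : ℂ)) *
      (∫ x : V, Complex.exp (-(Complex.I * ((inner ℝ x y : ℝ) : ℂ))) * M x) =
      ((2 * Real.pi : ℝ) : ℂ) ^ (Module.finrank ℝ V) * M q := by
  have hpi : (2 * Real.pi) ≠ 0 := by positivity
  have hpiC : (Real.pi : ℂ) ≠ 0 := by exact_mod_cast Real.pi_ne_zero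
  have key : ∀ y : V, ∫ x : V, Complex.exp (-(Complex.I * ((inner ℝ x y : ℝ) : ℂ))) * M x =
      (𝓕 M) ((2 * Real.pi)⁻¹ • y) := by
    intro y
    rw [SchwartzMap.fourier_coe, Real.fourier_eq']
    congr 1
    ext x
    rw [smul_eq_mul, inner_smul_right]
    congr 2
    push_cast
    field_simp
  refine ⟨?_, ?_⟩
  · simp_rw [key]
    exact ((𝓕 M).integrable (μ := volume)).comp_smul (inv_ne_zero hpi)
  · intro q
    simp_rw [key]
    have h1 : ∀ y : V, Complex.exp (Complex.I * ((inner ℝ q y : ℝ) : ℂ)) *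
        (𝓕 M) ((2 * Real.pi)⁻¹ • y) =
        (fun w : V => Complex.exp (((2 * Real.pi * inner ℝ w q : ℝ) : ℂ) * Complex.I) • (𝓕 M : SchwartzMap V ℂ) w)
          ((2 * Real.pi)⁻¹ • y) := by
      intro y
      simp only [smul_eq_mul, inner_smul_left]
      congr 2
      rw [real_inner_comm]
      simp only [conj_trivial]
      push_cast
      field_simp
    rw [integral_congr_ae (Filter.Eventually.of_forall h1)]
    rw [Measure.integral_comp_smul volume (fun w : V => Complex.exp (((2 * Real.pi * inner ℝ w q : ℝ) : ℂ) * Complex.I) • (𝓕 M : SchwartzMap V ℂ) w)]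
    have h2 : ∫ w : V, Complex.exp (((2 * Real.pi * inner ℝ w q : ℝ) : ℂ) * Complex.I) • (𝓕 M : SchwartzMap V ℂ) w = M q := by
      rw [← Real.fourierInv_eq', ← SchwartzMap.fourierInv_coe, FourierTransform.fourierInv_fourier_eq]
    rw [h2, abs_of_nonneg (by positivity), inv_pow, inv_inv, Complex.real_smul]
    push_cast
    rfl

lemma sqrtC : (Real.sqrt (2 * Real.pi) : ℂ) ≠ 0 := by
  have : 0 < Real.sqrt (2 * Real.pi) := by positivity
  exact_mod_cast this.ne'

lemma sqrtC_sq : (Real.sqrt (2 * Real.pi) : ℂ) ^ 2 = ((2 * Real.pi : ℝ) : ℂ) := by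
  rw [← Complex.ofReal_pow, Real.sq_sqrt (by positivity)]

lemma FT_integrable (f : SchwartzMap ℝ ℂ) : Integrable (FT f) := by
  have h := (schw_inv f).1
  refine (h.const_mul ((Real.sqrt (2 * Real.pi) : ℂ)⁻¹)).congr (Filter.Eventually.of_forall fun y => ?_)
  simp only [FT, RCLike.inner_apply, conj_trivial, Complex.ofReal_mul]
  congr 2
  ext x
  congr 2
  ring

lemma FT_inv (f : SchwartzMap ℝ ℂ) (u : ℝ) :
    ∫ ξ : ℝ, Complex.exp (Complex.I * (u : ℂ) * (ξ : ℂ)) * FT f ξ =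
      (Real.sqrt (2 * Real.pi) : ℂ) * f u := by
  have h := (schw_inv f).2 u
  have h2 : ∀ ξ : ℝ, Complex.exp (Complex.I * (u : ℂ) * (ξ : ℂ)) * FT f ξ =
     (Real.sqrt (2 * Real.pi) : ℂ)⁻¹ * (Complex.exp (Complex.I * ((inner ℝ u ξ : ℝ) : ℂ)) *
      (∫ x : ℝ, Complex.exp (-(Complex.I * ((inner ℝ x ξ : ℝ) : ℂ))) * f x)) := by
    intro ξ
    simp only [FT, RCLike.inner_apply, conj_trivial, Complex.ofReal_mul]
    rw [mul_left_comm]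
    congr 3
    · ring
    · ext x; congr 2; ring
  simp_rw [h2]
  rw [integral_const_mul, h, Module.finrank_self, pow_one, ← sqrtC_sq]
  have := sqrtC
  field_simp

lemma FTe_integrable (f : SchwartzMap ℝ ℂ) (u : ℝ) :
    Integrable (fun ξ : ℝ => Complex.exp (Complex.I * (u : ℂ) * (ξ : ℂ)) * FT f ξ) := by
  refine (FT_integrable f).bdd_mul (c := 1) (Continuous.aestronglyMeasurable (by fun_prop)) ?_
  refine Filter.Eventually.of_forall fun ξ => ?_
  rw [Complex.norm_exp]
  simp

def prodΦ (a b c : ℝ → ℂ) (u v w : ℝ) (q : ℝ × ℝ × ℝ) : ℂ :=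
  (Complex.exp (Complex.I * (u : ℂ) * (q.1 : ℂ)) * FT a q.1) *
    ((Complex.exp (Complex.I * (v : ℂ) * (q.2.1 : ℂ)) * FT b q.2.1) *
     (Complex.exp (Complex.I * (w : ℂ) * (q.2.2 : ℂ)) * FT c q.2.2))

lemma prodΦ_integrable (a b c : SchwartzMap ℝ ℂ) (u v w : ℝ) :
    Integrable (prodΦ a b c u v w) :=
  (FTe_integrable a u).mul_prod ((FTe_integrable b v).mul_prod (FTe_integrable c w))

lemma prodΦ_integral (a b c : SchwartzMap ℝ ℂ) (u v w : ℝ) :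
    ∫ q, prodΦ a b c u v w q = (Real.sqrt (2 * Real.pi) : ℂ) ^ 3 * (a u * (b v * c w)) := by
  unfold prodΦ
  rw [Measure.volume_eq_prod, integral_prod_mul (fun x : ℝ => Complex.exp (Complex.I * (u : ℂ) * (x : ℂ)) * FT a x)
    (fun r : ℝ × ℝ => (Complex.exp (Complex.I * (v : ℂ) * (r.1 : ℂ)) * FT b r.1) *
     (Complex.exp (Complex.I * (w : ℂ) * (r.2 : ℂ)) * FT c r.2)),
    Measure.volume_eq_prod, integral_prod_mul (fun x : ℝ => Complex.exp (Complex.I * (v : ℂ) * (x : ℂ)) * FT b x)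
    (fun x : ℝ => (Complex.exp (Complex.I * (w : ℂ) * (x : ℂ)) * FT c x)),
    FT_inv, FT_inv, FT_inv]
  ring

/-- Minkowski's integral inequality in the form needed. -/
lemma minkowski_fin {Y : Type*} [MeasurableSpace Y] (μ : Measure Y) [IsFiniteMeasure μ]
    (u : ℝ → Y → ℝ≥0∞) (hu : Measurable (Function.uncurry u)) (p : ℝ≥0∞) (hp : 1 ≤ p)
    (A : ℝ≥0∞) (hA : ∀ y, eLpNorm (fun x => u x y) p volume ≤ A) :
    eLpNorm (fun x => ∫⁻ y, u x y ∂μ) p volume ≤ μ Set.univ * A := by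
  by_cases hpt : p = ∞
  · subst hpt
    simp only [eLpNorm_exponent_top] at hA ⊢
    have h1 : ∀ᵐ y ∂μ, ∀ᵐ x : ℝ, u x y ≤ A := by
      refine Filter.Eventually.of_forall fun y => ?_
      filter_upwards [enorm_ae_le_eLpNormEssSup (fun x => u x y) volume] with x hx
      exact le_trans (by simpa using hx) (hA y)
    have h2 : ∀ᵐ x : ℝ, ∀ᵐ y ∂μ, u x y ≤ A := by
      rw [Measure.ae_ae_comm]
      · exact h1
      · exact measurableSet_le hu measurable_const
    refine eLpNormEssSup_le_of_ae_enorm_bound ?_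
    filter_upwards [h2] with x hx
    simp only [enorm_eq_self]
    calc ∫⁻ y, u x y ∂μ ≤ ∫⁻ y, A ∂μ := lintegral_mono_ae hx
      _ = _ := by rw [lintegral_const, mul_comm]
  · have hp0 : p ≠ 0 := by rintro rfl; simp at hp
    set r := p.toReal with hr
    have hr1 : 1 ≤ r := by
      rw [hr, ← ENNReal.toReal_one]; exact ENNReal.toReal_mono hpt hp
    have hr0 : 0 < r := by linarith
    have hA' : ∀ y, ∫⁻ x, (u x y) ^ r ≤ A ^ r := by
      intro y
      have := hA y
      rw [eLpNorm_eq_lintegral_rpow_enorm_toReal hp0 hpt] at this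
      simp only [enorm_eq_self] at this
      rw [← hr] at this
      have h3 := ENNReal.rpow_le_rpow this hr0.le
      rwa [← ENNReal.rpow_mul, one_div, inv_mul_cancel₀ hr0.ne', ENNReal.rpow_one] at h3
    rw [eLpNorm_eq_lintegral_rpow_enorm_toReal hp0 hpt]
    simp only [enorm_eq_self]
    rw [← hr]
    have hJ : ∀ x, (∫⁻ y, u x y ∂μ) ^ r ≤ (∫⁻ y, (u x y) ^ r ∂μ) * μ Set.univ ^ (r - 1) := by
      intro x
      have hm : Measurable (u x) := hu.comp measurable_prodMk_left
      have h := eLpNorm'_le_eLpNorm'_mul_rpow_measure_univ (μ := μ) (f := u x) one_pos hr1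
        hm.aestronglyMeasurable
      simp only [eLpNorm', enorm_eq_self, ENNReal.rpow_one, div_one] at h
      have h3 := ENNReal.rpow_le_rpow h hr0.le
      rw [ENNReal.mul_rpow_of_nonneg _ _ hr0.le, ← ENNReal.rpow_mul, ← ENNReal.rpow_mul,
        one_div, inv_mul_cancel₀ hr0.ne', ENNReal.rpow_one] at h3
      convert h3 using 3
      field_simp
    have hur : Measurable (fun z : ℝ × Y => (u z.1 z.2) ^ r) := hu.pow_const r
    calc (∫⁻ x, (∫⁻ y, u x y ∂μ) ^ r) ^ (1 / r)
        ≤ (∫⁻ x, (∫⁻ y, (u x y) ^ r ∂μ) * μ Set.univ ^ (r - 1)) ^ (1 / r) := by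
          gcongr with x; exact hJ x
      _ = ((∫⁻ y, (∫⁻ x, (u x y) ^ r) ∂μ) * μ Set.univ ^ (r - 1)) ^ (1 / r) := by
          rw [lintegral_mul_const _ hur.lintegral_prod_right', lintegral_lintegral_swap hur.aemeasurable]
      _ ≤ ((∫⁻ y, A ^ r ∂μ) * μ Set.univ ^ (r - 1)) ^ (1 / r) := by
          gcongr with y; exact hA' y
      _ = ((μ Set.univ * A) ^ r) ^ (1 / r) := by
          congr 1
          rw [lintegral_const, mul_assoc, ENNReal.mul_rpow_of_nonneg _ _ hr0.le, mul_comm]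
          congr 1
          have : r = 1 + (r - 1) := by ring
          conv_rhs => rw [this]
          rw [ENNReal.rpow_add_of_nonneg _ _ zero_le_one (by linarith), ENNReal.rpow_one]
      _ = _ := by
          rw [← ENNReal.rpow_mul, one_div, mul_inv_cancel₀ hr0.ne', ENNReal.rpow_one]

lemma enorm_le_top (g : SchwartzMap ℝ ℂ) (x : ℝ) : ‖g x‖ₑ ≤ eLpNorm (⇑g) ∞ volume := by
  have h : Dense {x | ‖g x‖ₑ ≤ eLpNorm (⇑g) ∞ volume} := by
    apply Measure.dense_of_ae (μ := (volume : Measure ℝ))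
    rw [eLpNorm_exponent_top]
    exact enorm_ae_le_eLpNormEssSup _ _
  have hc : IsClosed {x | ‖g x‖ₑ ≤ eLpNorm (⇑g) ∞ volume} :=
    isClosed_le (g.continuous.enorm) continuous_const
  have := hc.closure_eq ▸ h x
  exact this

abbrev E3 : Type := WithLp 2 (ℝ × WithLp 2 (ℝ × ℝ))

def e3 : E3 ≃L[ℝ] ℝ × ℝ × ℝ :=
  (WithLp.prodContinuousLinearEquiv 2 ℝ ℝ (WithLp 2 (ℝ × ℝ))).trans
    ((ContinuousLinearEquiv.refl ℝ ℝ).prodCongr (WithLp.prodContinuousLinearEquiv 2 ℝ ℝ ℝ))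

lemma e3_mp : MeasurePreserving (e3 : E3 → ℝ × ℝ × ℝ) volume volume := by
  have h1 := WithLp.volume_preserving_ofLp ℝ (WithLp 2 (ℝ × ℝ))
  have h2 := (MeasurePreserving.id (volume : Measure ℝ)).prod (WithLp.volume_preserving_ofLp ℝ ℝ)
  exact h2.comp h1

lemma e3_emb : MeasurableEmbedding (e3 : E3 → ℝ × ℝ × ℝ) :=
  e3.toHomeomorph.measurableEmbedding

def dot3 (p q : ℝ × ℝ × ℝ) : ℝ := p.1 * q.1 + p.2.1 * q.2.1 + p.2.2 * q.2.2

lemma e3_inner (x y : E3) : inner ℝ x y = dot3 (e3 x) (e3 y) := by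
  rw [WithLp.prod_inner_apply, WithLp.prod_inner_apply]
  simp only [RCLike.inner_apply, conj_trivial, dot3, e3]
  simp
  ring

lemma e3_finrank : Module.finrank ℝ E3 = 3 := by
  rw [e3.toLinearEquiv.finrank_eq]
  simp

lemma inv3_aux (m : SchwartzMap (ℝ × ℝ × ℝ) ℂ) :
    Integrable (fun y : ℝ × ℝ × ℝ => ∫ x : ℝ × ℝ × ℝ, Complex.exp (-(Complex.I * ((dot3 x y : ℝ) : ℂ))) * m x) ∧
    ∀ q : ℝ × ℝ × ℝ, ∫ y : ℝ × ℝ × ℝ, Complex.exp (Complex.I * ((dot3 q y : ℝ) : ℂ)) *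
      (∫ x : ℝ × ℝ × ℝ, Complex.exp (-(Complex.I * ((dot3 x y : ℝ) : ℂ))) * m x) =
      ((2 * Real.pi : ℝ) : ℂ) ^ 3 * m q := by
  obtain ⟨h1, h2⟩ := schw_inv (SchwartzMap.compCLMOfContinuousLinearEquiv ℂ e3 m)
  have h3 : ∀ y : E3, ∫ x : E3, Complex.exp (-(Complex.I * ((inner ℝ x y : ℝ) : ℂ))) *
      (SchwartzMap.compCLMOfContinuousLinearEquiv ℂ e3 m) x =
      ∫ x : ℝ × ℝ × ℝ, Complex.exp (-(Complex.I * ((dot3 x (e3 y) : ℝ) : ℂ))) * m x := by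
    intro y
    rw [← e3_mp.integral_comp e3_emb]
    simp only [e3_inner]
    rfl
  simp only [h3] at h1 h2
  constructor
  · exact (e3_mp.integrable_comp_emb e3_emb).1 h1
  · intro q
    have h4 := h2 (e3.symm q)
    rw [e3_finrank] at h4
    rw [← e3_mp.integral_comp e3_emb]
    simp only [e3_inner] at h4
    simpa using h4

lemma Finv3_eq (m : SchwartzMap (ℝ × ℝ × ℝ) ℂ) (y : ℝ × ℝ × ℝ) :
    Finv3 m y = ((Real.sqrt (2 * Real.pi) : ℂ) ^ 3)⁻¹ *
      ∫ x : ℝ × ℝ × ℝ, Complex.exp (-(Complex.I * ((dot3 x (-y) : ℝ) : ℂ))) * m x := by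
  simp only [Finv3]
  congr 2
  ext x
  congr 2
  simp only [dot3, Prod.fst_neg, Prod.snd_neg]
  push_cast
  ring

instance negInv3 : (volume : Measure (ℝ × ℝ × ℝ)).IsNegInvariant :=
  ⟨((Measure.measurePreserving_neg (volume : Measure ℝ)).prod
    ((Measure.measurePreserving_neg (volume : Measure ℝ)).prod
      (Measure.measurePreserving_neg (volume : Measure ℝ)))).map_eq⟩

lemma Finv3_integrable (m : SchwartzMap (ℝ × ℝ × ℝ) ℂ) : Integrable (Finv3 m) := by
  have h := ((inv3_aux m).1.comp_neg).const_mul ((Real.sqrt (2 * Real.pi) : ℂ) ^ 3)⁻¹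
  refine h.congr (Filter.Eventually.of_forall fun y => ?_)
  rw [Finv3_eq]

lemma Finv3_inv (m : SchwartzMap (ℝ × ℝ × ℝ) ℂ) (q : ℝ × ℝ × ℝ) :
    m q = ((Real.sqrt (2 * Real.pi) : ℂ) ^ 3)⁻¹ *
      ∫ y : ℝ × ℝ × ℝ, Complex.exp (-(Complex.I * ((dot3 q y : ℝ) : ℂ))) * Finv3 m y := by
  have h := (inv3_aux m).2 q
  rw [← integral_neg_eq_self] at h
  have h2 : ∀ y : ℝ × ℝ × ℝ, Complex.exp (-(Complex.I * ((dot3 q y : ℝ) : ℂ))) * Finv3 m y =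
      ((Real.sqrt (2 * Real.pi) : ℂ) ^ 3)⁻¹ * (Complex.exp (Complex.I * ((dot3 q (-y) : ℝ) : ℂ)) *
      (∫ x : ℝ × ℝ × ℝ, Complex.exp (-(Complex.I * ((dot3 x (-y) : ℝ) : ℂ))) * m x)) := by
    intro y
    rw [Finv3_eq, mul_left_comm]
    congr 3
    simp only [dot3, Prod.fst_neg, Prod.snd_neg]
    push_cast
    ring
  simp_rw [h2]
  rw [integral_const_mul, h, ← sqrtC_sq]
  have := sqrtC
  field_simp

lemma norm_exp_dot (q y : ℝ × ℝ × ℝ) : ‖Complex.exp (-(Complex.I * ((dot3 q y : ℝ) : ℂ)))‖ = 1 := by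
  rw [Complex.norm_exp]; simp

lemma dual3 (m : SchwartzMap (ℝ × ℝ × ℝ) ℂ) (Φ : ℝ × ℝ × ℝ → ℂ) (hΦ : Integrable Φ) :
    ∫ q, m q * Φ q = ((Real.sqrt (2 * Real.pi) : ℂ) ^ 3)⁻¹ *
      ∫ y, Finv3 m y * ∫ q, Complex.exp (-(Complex.I * ((dot3 q y : ℝ) : ℂ))) * Φ q := by
  have h1 : ∀ q, m q * Φ q = ((Real.sqrt (2 * Real.pi) : ℂ) ^ 3)⁻¹ *
      ∫ y, Complex.exp (-(Complex.I * ((dot3 q y : ℝ) : ℂ))) * (Φ q * Finv3 m y) := by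
    intro q
    rw [Finv3_inv m q, mul_assoc, ← integral_mul_const]
    congr 2
    ext y
    ring
  rw [integral_congr_ae (Filter.Eventually.of_forall h1), integral_const_mul]
  congr 1
  rw [integral_integral_swap]
  · congr 1
    ext y
    rw [← integral_const_mul]
    congr 1
    ext q
    ring
  · refine (hΦ.mul_prod (Finv3_integrable m)).bdd_mul (c := 1) (Continuous.aestronglyMeasurable ?_) ?_
    · unfold dot3; fun_prop
    · refine Filter.Eventually.of_forall fun z => ?_
      exact (norm_exp_dot _ _).le

lemma iter3 (m : SchwartzMap (ℝ × ℝ × ℝ) ℂ) (Φ : ℝ × ℝ × ℝ → ℂ) (hΦ : Integrable Φ) :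
    ∫ ξ : ℝ, ∫ ξ₁ : ℝ, ∫ ξ₂ : ℝ, m (ξ, ξ₁, ξ₂) * Φ (ξ, ξ₁, ξ₂) = ∫ q, m q * Φ q := by
  obtain ⟨B, hB⟩ : ∃ B, ∀ q, ‖m q‖ ≤ B := ⟨_, m.toBoundedContinuousFunction.norm_coe_le_norm⟩
  have hI : Integrable (fun q => m q * Φ q) :=
    hΦ.bdd_mul (c := B) m.continuous.aestronglyMeasurable (Filter.Eventually.of_forall hB)
  rw [Measure.volume_eq_prod] at hI ⊢
  rw [integral_prod _ hI]
  refine integral_congr_ae ?_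
  filter_upwards [hI.prod_right_ae] with ξ hξ
  rw [Measure.volume_eq_prod] at hξ ⊢
  rw [integral_prod _ hξ]

def shear : (ℝ × ℝ × ℝ) ≃ᵐ (ℝ × ℝ × ℝ) where
  toFun q := (q.1 - q.2.1, q.2)
  invFun q := (q.1 + q.2.1, q.2)
  left_inv q := by simp
  right_inv q := by simp
  measurable_toFun := by simp only [Equiv.coe_fn_mk]; fun_prop
  measurable_invFun := by simp only [Equiv.coe_fn_symm_mk]; fun_prop

lemma shear_mp : MeasurePreserving shear volume volume := by
  have h1 : MeasurePreserving (fun p : (ℝ × ℝ) × ℝ => (p.1, p.2 - p.1.1))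
      ((volume : Measure (ℝ × ℝ)).prod volume) ((volume : Measure (ℝ × ℝ)).prod volume) := by
    refine (MeasurePreserving.id _).skew_product (g := fun (r : ℝ × ℝ) (x : ℝ) => x - r.1) (by unfold Function.uncurry; fun_prop) ?_
    exact Filter.Eventually.of_forall fun r => (measurePreserving_sub_right volume r.1).map_eq
  have h2 := Measure.measurePreserving_swap (μ := (volume : Measure ℝ)) (ν := (volume : Measure (ℝ × ℝ)))
  have h3 := Measure.measurePreserving_swap (μ := (volume : Measure (ℝ × ℝ))) (ν := (volume : Measure ℝ))
  exact h3.comp (h1.comp h2)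

lemma TtriB_eq (m : SchwartzMap (ℝ × ℝ × ℝ) ℂ) (f g h : SchwartzMap ℝ ℂ) (x : ℝ) :
    TtriB m f g h x = (Real.sqrt (2 * Real.pi) : ℂ)⁻¹ *
      ∫ y : ℝ × ℝ × ℝ, Finv3 m y * (h (x - y.1) * (f (-y.2.1) * g (-y.2.2))) := by
  have h1 : TtriB m f g h x = (Real.sqrt (2 * Real.pi) : ℂ)⁻¹ *
      ∫ ξ : ℝ, ∫ ξ₁ : ℝ, ∫ ξ₂ : ℝ, m (ξ, ξ₁, ξ₂) * prodΦ h f g x 0 0 (ξ, ξ₁, ξ₂) := by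
    simp only [TtriB, ← integral_const_mul]
    congr! 7 with ξ ξ₁ ξ₂
    simp [prodΦ]
    ring
  rw [h1, iter3 _ _ (prodΦ_integrable h f g x 0 0), dual3 _ _ (prodΦ_integrable h f g x 0 0)]
  have h2 : ∀ y : ℝ × ℝ × ℝ, ∫ q, Complex.exp (-(Complex.I * ((dot3 q y : ℝ) : ℂ))) * prodΦ h f g x 0 0 q =
      (Real.sqrt (2 * Real.pi) : ℂ) ^ 3 * (h (x - y.1) * (f (-y.2.1) * g (-y.2.2))) := by
    intro y
    rw [← prodΦ_integral]
    congr 1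
    ext q
    have : Complex.exp (-(Complex.I * ((dot3 q y : ℝ) : ℂ))) =
      Complex.exp (Complex.I * ((-y.1 : ℝ) : ℂ) * (q.1 : ℂ)) *
      Complex.exp (Complex.I * ((-y.2.1 : ℝ) : ℂ) * (q.2.1 : ℂ)) *
      Complex.exp (Complex.I * ((-y.2.2 : ℝ) : ℂ) * (q.2.2 : ℂ)) := by
      rw [← Complex.exp_add, ← Complex.exp_add]
      congr 1
      simp only [dot3]
      push_cast
      ring
    have h5 : Complex.exp (Complex.I * ((x - y.1 : ℝ) : ℂ) * (q.1 : ℂ)) =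
      Complex.exp (Complex.I * (x : ℂ) * (q.1 : ℂ)) * Complex.exp (Complex.I * ((-y.1 : ℝ) : ℂ) * (q.1 : ℂ)) := by
      rw [← Complex.exp_add]
      congr 1
      push_cast
      ring
    simp only [prodΦ]
    rw [this, h5]
    simp only [Complex.ofReal_zero, mul_zero, zero_mul, Complex.exp_zero]
    ring
  simp_rw [h2]
  simp_rw [mul_left_comm (Finv3 (⇑m) _) ((Real.sqrt (2 * Real.pi) : ℂ) ^ 3) _]
  rw [integral_const_mul]
  have := sqrtC
  field_simp

lemma TtriA_eq (m : SchwartzMap (ℝ × ℝ × ℝ) ℂ) (f g h : SchwartzMap ℝ ℂ) (x : ℝ) :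
    TtriA m f g h x = (Real.sqrt (2 * Real.pi) : ℂ)⁻¹ *
      ∫ y : ℝ × ℝ × ℝ, Finv3 m y * (h (x - y.1) * (f (x - y.1 - y.2.1) * g (-y.2.2))) := by
  have hint : Integrable (fun q => prodΦ h f g x x 0 (shear q)) :=
    (shear_mp.integrable_comp_emb shear.measurableEmbedding).2 (prodΦ_integrable h f g x x 0)
  have h1 : TtriA m f g h x = (Real.sqrt (2 * Real.pi) : ℂ)⁻¹ *
      ∫ ξ : ℝ, ∫ ξ₁ : ℝ, ∫ ξ₂ : ℝ, m (ξ, ξ₁, ξ₂) * (fun q => prodΦ h f g x x 0 (shear q)) (ξ, ξ₁, ξ₂) := by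
    simp only [TtriA, ← integral_const_mul]
    congr! 7 with ξ ξ₁ ξ₂
    have h5 : Complex.exp (Complex.I * (x : ℂ) * (ξ : ℂ)) =
      Complex.exp (Complex.I * (x : ℂ) * ((ξ - ξ₁ : ℝ) : ℂ)) * Complex.exp (Complex.I * (x : ℂ) * (ξ₁ : ℂ)) := by
      rw [← Complex.exp_add]
      congr 1
      push_cast
      ring
    simp only [prodΦ, shear, MeasurableEquiv.coe_mk, Equiv.coe_fn_mk]
    rw [h5]
    simp only [Complex.ofReal_zero, mul_zero, zero_mul, Complex.exp_zero]
    ring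
  rw [h1, iter3 _ _ hint, dual3 _ _ hint]
  have h2 : ∀ y : ℝ × ℝ × ℝ, ∫ q, Complex.exp (-(Complex.I * ((dot3 q y : ℝ) : ℂ))) * prodΦ h f g x x 0 (shear q) =
      (Real.sqrt (2 * Real.pi) : ℂ) ^ 3 * (h (x - y.1) * (f (x - y.1 - y.2.1) * g (-y.2.2))) := by
    intro y
    rw [← prodΦ_integral, ← shear_mp.integral_comp shear.measurableEmbedding (prodΦ h f g (x - y.1) (x - y.1 - y.2.1) (-y.2.2))]
    congr 1
    ext q
    have : Complex.exp (-(Complex.I * ((dot3 q y : ℝ) : ℂ))) =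
      Complex.exp (Complex.I * ((-y.1 : ℝ) : ℂ) * ((q.1 - q.2.1 : ℝ) : ℂ)) *
      Complex.exp (Complex.I * ((-y.1 - y.2.1 : ℝ) : ℂ) * (q.2.1 : ℂ)) *
      Complex.exp (Complex.I * ((-y.2.2 : ℝ) : ℂ) * (q.2.2 : ℂ)) := by
      rw [← Complex.exp_add, ← Complex.exp_add]
      congr 1
      simp only [dot3]
      push_cast
      ring
    have h5 : ∀ a b c : ℝ, Complex.exp (Complex.I * ((a + b : ℝ) : ℂ) * (c : ℂ)) =
      Complex.exp (Complex.I * (a : ℂ) * (c : ℂ)) * Complex.exp (Complex.I * (b : ℂ) * (c : ℂ)) := by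
      intro a b c
      rw [← Complex.exp_add]
      congr 1
      push_cast
      ring
    have e1 : x - y.1 = x + (-y.1) := by ring
    have e2 : x - y.1 - y.2.1 = x + (-y.1 - y.2.1) := by ring
    simp only [prodΦ, shear, MeasurableEquiv.coe_mk, Equiv.coe_fn_mk]
    rw [this, e2, e1, h5, h5]
    simp only [Complex.ofReal_zero, mul_zero, zero_mul, Complex.exp_zero]
    ring
  simp_rw [h2]
  simp_rw [mul_left_comm (Finv3 (⇑m) _) ((Real.sqrt (2 * Real.pi) : ℂ) ^ 3) _]
  rw [integral_const_mul]
  have := sqrtC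
  field_simp

lemma general_bound (m : SchwartzMap (ℝ × ℝ × ℝ) ℂ) (T : ℝ → ℂ) (U : ℝ → ℝ × ℝ × ℝ → ℂ)
    (hU : Continuous (Function.uncurry U))
    (hT : ∀ x, T x = (Real.sqrt (2 * Real.pi) : ℂ)⁻¹ * ∫ y : ℝ × ℝ × ℝ, Finv3 m y * U x y)
    (p : ℝ≥0∞) (hp : 1 ≤ p) (A : ℝ≥0∞) (hA : ∀ y, eLpNorm (fun x => U x y) p volume ≤ A) :
    eLpNorm T p volume ≤ (∫⁻ q : ℝ × ℝ × ℝ, ‖Finv3 m q‖₊) * A := by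
  have hK := Finv3_integrable m
  have hKm : AEMeasurable (fun y => ‖Finv3 m y‖ₑ) := hK.1.enorm
  have hfin : ∫⁻ y, ‖Finv3 m y‖ₑ < ∞ := hK.2
  set μ : Measure (ℝ × ℝ × ℝ) := volume.withDensity (fun y => ‖Finv3 m y‖ₑ) with hμ
  have hμu : μ Set.univ = ∫⁻ y, ‖Finv3 m y‖ₑ := by rw [hμ, withDensity_apply _ MeasurableSet.univ]; simp
  have : IsFiniteMeasure μ := ⟨by rw [hμu]; exact hfin⟩
  have hc : ‖(Real.sqrt (2 * Real.pi) : ℂ)⁻¹‖ ≤ 1 := by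
    rw [norm_inv, Complex.norm_real, Real.norm_of_nonneg (Real.sqrt_nonneg _)]
    apply inv_le_one_of_one_le₀
    rw [Real.one_le_sqrt]
    nlinarith [Real.pi_gt_three]
  have hc' : ‖(Real.sqrt (2 * Real.pi) : ℂ)⁻¹‖ₑ ≤ 1 := by
    rw [← ofReal_norm, ← ENNReal.ofReal_one]; exact ENNReal.ofReal_le_ofReal hc
  have hu : Measurable (Function.uncurry (fun x y => ‖U x y‖ₑ)) := hU.enorm.measurable
  have hle : ∀ x, ‖T x‖ₑ ≤ ‖∫⁻ y, ‖U x y‖ₑ ∂μ‖ₑ := by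
    intro x
    rw [hT, enorm_mul, enorm_eq_self]
    calc _ ≤ 1 * ‖∫ y : ℝ × ℝ × ℝ, Finv3 m y * U x y‖ₑ := by gcongr
      _ ≤ ∫⁻ y, ‖Finv3 m y * U x y‖ₑ := by rw [one_mul]; exact enorm_integral_le_lintegral_enorm _
      _ = ∫⁻ y, ‖U x y‖ₑ ∂μ := by
        have hm : Measurable (fun y => ‖U x y‖ₑ) := hu.comp measurable_prodMk_left
        rw [hμ, lintegral_withDensity_eq_lintegral_mul₀ hKm hm.aemeasurable]
        simp [enorm_mul]
  calc eLpNorm T p volume ≤ eLpNorm (fun x => ∫⁻ y, ‖U x y‖ₑ ∂μ) p volume := eLpNorm_mono_enorm hle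
    _ ≤ μ Set.univ * A := minkowski_fin μ (fun x y => ‖U x y‖ₑ) hu p hp A (fun y => by
        simpa using hA y)
    _ = _ := by rw [hμu]; rfl

lemma eLpNorm_shift (h : SchwartzMap ℝ ℂ) (a : ℝ) (p : ℝ≥0∞) :
    eLpNorm (fun x => h (x - a)) p volume = eLpNorm h p volume :=
  eLpNorm_comp_measurePreserving h.continuous.aestronglyMeasurable (measurePreserving_sub_right volume a)

/-- Hölder-type bounds for the modified trilinear operators `T_𝔪⁽ᵃ⁾` and `T_𝔪⁽ᵇ⁾`. -/
theorem modified_trilinear_operator_bounds :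
    ∃ C : ℝ, 0 < C ∧
      ∀ m : SchwartzMap (ℝ × ℝ × ℝ) ℂ,
        (∀ p p₁ p₂ : ℝ≥0∞, 1 ≤ p → 1 ≤ p₁ → 1 ≤ p₂ → p⁻¹ = p₁⁻¹ + p₂⁻¹ →
          ∀ f g h : SchwartzMap ℝ ℂ,
            eLpNorm (TtriA (⇑m) (⇑f) (⇑g) (⇑h)) p volume ≤
              ENNReal.ofReal C * (∫⁻ q : ℝ × ℝ × ℝ, ‖Finv3 (⇑m) q‖₊) *
                eLpNorm (⇑f) p₁ volume * eLpNorm (⇑g) ∞ volume *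
                  eLpNorm (⇑h) p₂ volume) ∧
        ∀ p : ℝ≥0∞, 1 ≤ p →
          ∀ f g h : SchwartzMap ℝ ℂ,
            eLpNorm (TtriB (⇑m) (⇑f) (⇑g) (⇑h)) p volume ≤
              ENNReal.ofReal C * (∫⁻ q : ℝ × ℝ × ℝ, ‖Finv3 (⇑m) q‖₊) *
                eLpNorm (⇑f) ∞ volume * eLpNorm (⇑g) ∞ volume *
                  eLpNorm (⇑h) p volume := by

  refine ⟨1, one_pos, fun m => ⟨?_, ?_⟩⟩
  · intro p p₁ p₂ hp hp₁ hp₂ hpp f g h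
    have hf := f.continuous
    have hg := g.continuous
    have hh := h.continuous
    refine (general_bound m _ (fun x y => h (x - y.1) * (f (x - y.1 - y.2.1) * g (-y.2.2)))
      (by unfold Function.uncurry; fun_prop) (TtriA_eq m f g h) p hp
      (eLpNorm f p₁ volume * eLpNorm g ∞ volume * eLpNorm h p₂ volume) ?_).trans (le_of_eq ?_)
    · intro y
      have : ENNReal.HolderTriple p₁ p₂ p := ⟨hpp.symm⟩
      have h1 : eLpNorm (fun x => f (x - (y.1 + y.2.1)) * h (x - y.1)) p volume ≤
          eLpNorm f p₁ volume * eLpNorm h p₂ volume := by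
        have := eLpNorm_smul_le_mul_eLpNorm (μ := (volume : Measure ℝ)) (p := p₁) (q := p₂) (r := p)
          (f := fun x => h (x - y.1)) (φ := fun x => f (x - (y.1 + y.2.1)))
          (Continuous.aestronglyMeasurable (by fun_prop)) (Continuous.aestronglyMeasurable (by fun_prop))
        rwa [eLpNorm_shift, eLpNorm_shift] at this
      have h2 : (fun x => h (x - y.1) * (f (x - y.1 - y.2.1) * g (-y.2.2))) =
          g (-y.2.2) • (fun x => f (x - (y.1 + y.2.1)) * h (x - y.1)) := by
        ext x
        simp only [Pi.smul_apply, smul_eq_mul]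
        rw [sub_sub]
        ring
      rw [h2, eLpNorm_const_smul]
      calc _ ≤ eLpNorm g ∞ volume * (eLpNorm f p₁ volume * eLpNorm h p₂ volume) := by
            gcongr; exact enorm_le_top g _
        _ = _ := by ring
    · rw [ENNReal.ofReal_one]; ring
  · intro p hp f g h
    have hf := f.continuous
    have hg := g.continuous
    have hh := h.continuous
    refine (general_bound m _ (fun x y => h (x - y.1) * (f (-y.2.1) * g (-y.2.2)))
      (by unfold Function.uncurry; fun_prop) (TtriB_eq m f g h) p hp
      (eLpNorm f ∞ volume * eLpNorm g ∞ volume * eLpNorm h p volume) ?_).trans (le_of_eq ?_)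
    · intro y
      have h2 : (fun x => h (x - y.1) * (f (-y.2.1) * g (-y.2.2))) =
          (f (-y.2.1) * g (-y.2.2)) • (fun x => h (x - y.1)) := by
        ext x
        simp only [Pi.smul_apply, smul_eq_mul]
        ring
      rw [h2, eLpNorm_const_smul, eLpNorm_shift, enorm_mul]
      gcongr
      · exact enorm_le_top f _
      · exact enorm_le_top g _
    · rw [ENNReal.ofReal_one]; ring
end
end
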